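/- Fix N ≥ 1, initial data θ₁⁰,…,θ_N⁰, ω₁⁰,…,ω_N⁰ ∈ ℝ, natural frequencies ν₁,…,ν_N ∈ ℝ, κ > 0, and m > 0. Let θᵢ(m,t) denote the solution of the inertial Kuramoto model with these data, and θᵢ(0,t) the solution of the first-order Kuramoto model with initial data θ₁⁰,…,θ_N⁰. Then for every integer n ≥ 2, every i ∈ {1,…,N}, and every t ≥ 0, |θᵢ^{(n)}(m,t) − θᵢ^{(n)}(0,t)| ≤ (n−1)! (2κ + ‖Ω⁰‖_∞ + ‖V‖_∞ + 9/(8m))ⁿ (1 + t/m)ⁿ e^{−t/m} + (9/8) mκ · n! · e^{2κt} (2κ + D(Ω⁰) + D(V) + 9/(8m))ⁿ (1 + t/m)ⁿ e^{−t/m} + (3/4) mκ · (n+1)! · e^{2κt} (2κ + D(Ω⁰) + D(V))ⁿ (1 − e^{−t/m}), where ‖X‖_∞ = max_i|xᵢ| and D(X) = max_{i,j}|xᵢ−xⱼ| for X ∈ ℝ^N, Ω⁰ = (ω₁⁰,…,ω_N⁰), and V = (ν₁,…,ν_N). -/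

import Mathlib

open Filter Topology MeasureTheory intervalIntegral

noncomputable section

/-- A global smooth solution of the inertial Kuramoto model
`m θ̈ᵢ + θ̇ᵢ = νᵢ + (κ/N) ∑ⱼ sin(θⱼ - θᵢ)` with initial data `θᵢ(0) = θ0 i`,
`θ̇ᵢ(0) = ω0 i`. -/
def IsInertialSol (N : ℕ) (m κ : ℝ) (ν θ0 ω0 : Fin N → ℝ) (θ : Fin N → ℝ → ℝ) : Prop :=
  (∀ i, ContDiff ℝ ⊤ (θ i)) ∧
  (∀ i, θ i 0 = θ0 i) ∧
  (∀ i, deriv (θ i) 0 = ω0 i) ∧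
  (∀ i, ∀ t : ℝ, 0 ≤ t →
    m * deriv (deriv (θ i)) t + deriv (θ i) t
      = ν i + (κ / N) * ∑ j, Real.sin (θ j t - θ i t))

/-- A global smooth solution of the first-order Kuramoto model
`θ̇ᵢ = νᵢ + (κ/N) ∑ⱼ sin(θⱼ - θᵢ)` with initial data `θᵢ(0) = θ0 i`. -/
def IsFirstOrderSol (N : ℕ) (κ : ℝ) (ν θ0 : Fin N → ℝ) (θ : Fin N → ℝ → ℝ) : Prop :=
  (∀ i, ContDiff ℝ (⊤ : ℕ∞) (θ i)) ∧
  (∀ i, θ i 0 = θ0 i) ∧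
  (∀ i, ∀ t : ℝ, 0 ≤ t →
    deriv (θ i) t = ν i + (κ / N) * ∑ j, Real.sin (θ j t - θ i t))


/-- smooth functions have derivatives of all orders -/
lemma ku_hasDerivAt {f : ℝ → ℝ} (hf : ContDiff ℝ (⊤ : ℕ∞) f) (n : ℕ) (t : ℝ) :
    HasDerivAt (iteratedDeriv n f) (iteratedDeriv (n + 1) f t) t := by
  rw [iteratedDeriv_succ]
  apply DifferentiableAt.hasDerivAt
  exact (hf.differentiable_iteratedDeriv n (by exact_mod_cast WithTop.coe_lt_top n)).differentiableAt

lemma ku_at {f : ℝ → ℝ} (hf : ContDiff ℝ (⊤ : ℕ∞) f) (n : ℕ) (t : ℝ) : ContDiffAt ℝ n f t :=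
  (hf.of_le (by exact_mod_cast le_top)).contDiffAt

lemma ku_eq_on {f g : ℝ → ℝ} (hf : ContDiff ℝ (⊤ : ℕ∞) f) (hg : ContDiff ℝ (⊤ : ℕ∞) g)
    (h : ∀ t, 0 ≤ t → f t = g t) (n : ℕ) :
    ∀ t, 0 ≤ t → iteratedDeriv n f t = iteratedDeriv n g t := by
  induction n with
  | zero => simpa using h
  | succ n ih =>
    intro t ht
    have h1 := (ku_hasDerivAt hf n t).hasDerivWithinAt (s := Set.Ici 0)
    have h2 := (ku_hasDerivAt hg n t).hasDerivWithinAt (s := Set.Ici 0)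
    have h3 := h2.congr (f₁ := iteratedDeriv n f) (fun x hx => ih x hx) (ih t ht)
    exact (uniqueDiffOn_Ici (0:ℝ) t ht).eq_deriv _ h1 h3

lemma ku_deriv_smooth {f : ℝ → ℝ} (hf : ContDiff ℝ (⊤ : ℕ∞) f) :
    ContDiff ℝ (⊤ : ℕ∞) (deriv f) := by
  exact (contDiff_infty_iff_deriv.1 hf).2

/-- comparison lemma for first order linear inequalities -/
lemma ku_comp_aux {m : ℝ} (hm : 0 < m) (g g' : ℝ → ℝ) (hg : ∀ t, HasDerivAt g (g' t) t)
    (h0 : 0 ≤ g 0) (h : ∀ t, 0 ≤ t → 0 ≤ m * g' t + g t) : ∀ t, 0 ≤ t → 0 ≤ g t := by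
  intro t ht
  have hd : ∀ s, HasDerivAt (fun s => Real.exp (s / m) * g s)
      (Real.exp (s / m) * (1 / m) * g s + Real.exp (s / m) * g' s) s := by
    intro s
    exact (((hasDerivAt_id s).div_const m).exp).mul (hg s)
  have hmono : MonotoneOn (fun s => Real.exp (s / m) * g s) (Set.Ici 0) := by
    apply monotoneOn_of_deriv_nonneg (convex_Ici 0)
    · exact fun s _ => (hd s).continuousAt.continuousWithinAt
    · exact fun s _ => (hd s).differentiableAt.differentiableWithinAt
    · intro s hs
      rw [interior_Ici] at hs
      rw [(hd s).deriv]
      have := h s (le_of_lt hs)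
      have e : Real.exp (s / m) * (1 / m) * g s + Real.exp (s / m) * g' s
        = Real.exp (s / m) / m * (m * g' s + g s) := by field_simp; ring
      rw [e]; positivity
  have := hmono (Set.mem_Ici.2 le_rfl) (Set.mem_Ici.2 ht) ht
  simp at this
  have h2 : 0 ≤ Real.exp (t / m) * g t := le_trans h0 this
  exact nonneg_of_mul_nonneg_right h2 (Real.exp_pos _)

lemma ku_comp {m : ℝ} (hm : 0 < m) (f f' B B' : ℝ → ℝ) (hf : ∀ t, HasDerivAt f (f' t) t)
    (hB : ∀ t, HasDerivAt B (B' t) t) (h0 : |f 0| ≤ B 0)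
    (h : ∀ t, 0 ≤ t → |m * f' t + f t| ≤ m * B' t + B t) : ∀ t, 0 ≤ t → |f t| ≤ B t := by
  intro t ht
  rw [abs_le] at h0 ⊢
  have h1 := ku_comp_aux hm (fun t => B t - f t) (fun t => B' t - f' t)
    (fun t => (hB t).sub (hf t)) (sub_nonneg.2 h0.2)
    (fun s hs => by have := abs_le.1 (h s hs); nlinarith [this.1, this.2]) t ht
  have h2 := ku_comp_aux hm (fun t => B t + f t) (fun t => B' t + f' t)
    (fun t => (hB t).add (hf t))
    (by have : 0 ≤ B 0 + f 0 := by linarith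
        exact this)
    (fun s hs => by have := abs_le.1 (h s hs); nlinarith [this.1, this.2]) t ht
  constructor <;> linarith

/-- Gronwall type lemma -/
lemma ku_gron {ι : Type} [Fintype ι] [Nonempty ι] (z z' : ι → ℝ → ℝ)
    (hz : ∀ i t, HasDerivAt (z i) (z' i t) t) (B B' c : ℝ → ℝ) (hB : ∀ t, HasDerivAt B (B' t) t)
    (K : ℝ) (h0 : ∀ i, |z i 0| ≤ B 0)
    (h : ∀ t, 0 ≤ t → ∀ M, (∀ i, |z i t| ≤ M) → ∀ i, |z' i t| ≤ K * M + c t)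
    (hBc : ∀ t, 0 ≤ t → K * B t + c t ≤ B' t) :
    ∀ t, 0 ≤ t → ∀ i, |z i t| ≤ B t := by
  intro T hT
  have key : ∀ ε, 0 < ε → ∀ i, |z i T| ≤ B T + ε * Real.exp ((K + 1) * T) := by
    intro ε hε i
    have hf : ∀ t, HasDerivAt (fun t => (fun i => z i t)) (fun i => z' i t) t :=
      fun t => hasDerivAt_pi.2 (fun i => hz i t)
    have hB2 : ∀ t, HasDerivAt (fun t => B t + ε * Real.exp ((K + 1) * t))
        (B' t + ε * (Real.exp ((K + 1) * t) * ((K + 1) * 1))) t := fun t =>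
      (hB t).add ((((hasDerivAt_id t).const_mul (K + 1)).exp).const_mul ε)
    have hn : ∀ t, 0 ≤ t → ∀ M, ‖(fun i => z i t)‖ = M → ‖(fun i => z' i t)‖ ≤ K * M + c t := by
      intro t ht M hM
      have h1 : ∀ i, |z i t| ≤ M := fun i => by
        rw [← hM]; exact norm_le_pi_norm (fun i => z i t) i
      have h2 := h t ht M h1
      apply (pi_norm_le_iff_of_nonneg ?_).2 h2
      exact le_trans (abs_nonneg _) (h2 i)
    have := image_norm_le_of_norm_deriv_right_lt_deriv_boundary (a := 0) (b := T)
      (f := fun t => (fun i => z i t)) (f' := fun t => (fun i => z' i t))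
      (fun t _ => (hf t).continuousAt.continuousWithinAt)
      (fun t _ => (hf t).hasDerivWithinAt)
      (B := fun t => B t + ε * Real.exp ((K + 1) * t)) (by
        apply (pi_norm_le_iff_of_nonneg ?_).2
        · intro i
          have := h0 i
          simp; linarith
        · have := le_trans (abs_nonneg _) (h0 i)
          simp; linarith) hB2 (by
        intro t ht heq
        refine lt_of_le_of_lt (hn t ht.1 _ heq) ?_
        have h3 := hBc t ht.1
        have h4 : 0 < ε * Real.exp ((K + 1) * t) := by positivity
        nlinarith) (x := T) ⟨hT, le_rfl⟩
    exact le_trans (norm_le_pi_norm (fun i => z i T) i) this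
  intro i
  apply le_of_forall_pos_le_add
  intro δ hδ
  have := key (δ / Real.exp ((K + 1) * T)) (by positivity) i
  rwa [div_mul_cancel₀ _ (Real.exp_pos _).ne'] at this

lemma ku_fact (k l : ℕ) (h : l ≤ k) :
    (k.choose l : ℝ) * ((l.factorial : ℝ) * ((k - l).factorial : ℝ)) = (k.factorial : ℝ) := by
  have := Nat.choose_mul_factorial_mul_factorial h
  rw [← mul_assoc]
  exact_mod_cast this

lemma ku_sin_smooth {f : ℝ → ℝ} (hf : ContDiff ℝ (⊤ : ℕ∞) f) (α : ℝ) :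
    ContDiff ℝ (⊤ : ℕ∞) (fun t => Real.sin (f t + α)) :=
  Real.contDiff_sin.comp (hf.add contDiff_const)

lemma ku_sin_succ {f : ℝ → ℝ} (hf : ContDiff ℝ (⊤ : ℕ∞) f) (α : ℝ) (k : ℕ) (t : ℝ) :
    iteratedDeriv (k + 1) (fun t => Real.sin (f t + α)) t =
      ∑ l ∈ Finset.range (k + 1), (k.choose l : ℝ) * iteratedDeriv (l + 1) f t *
        iteratedDeriv (k - l) (fun t => Real.sin (f t + (α + Real.pi / 2))) t := by
  rw [iteratedDeriv_succ']
  have e : deriv (fun t => Real.sin (f t + α)) =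
      (deriv f) * (fun t => Real.sin (f t + (α + Real.pi / 2))) := by
    funext s
    have h1 : HasDerivAt f (deriv f s) s := (hf.differentiable (by simp)).differentiableAt.hasDerivAt
    rw [((h1.add_const α).sin).deriv, Pi.mul_apply, ← add_assoc, Real.sin_add_pi_div_two, mul_comm]
  rw [e, iteratedDeriv_mul (ku_at (ku_deriv_smooth hf) _ _) (ku_at (ku_sin_smooth hf _) _ _)]
  refine Finset.sum_congr rfl fun l _ => ?_
  rw [iteratedDeriv_succ']

lemma ku_sin_bound {f : ℝ → ℝ} (hf : ContDiff ℝ (⊤ : ℕ∞) f) (t : ℝ) (H : ℕ → ℝ)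
    (H0 : ∀ k, 0 ≤ H k) (H1 : 1 ≤ H 0) (Hm : ∀ a b, H a * H b ≤ H (a + b)) (n : ℕ)
    (hb : ∀ k, k < n → |iteratedDeriv (k + 1) f t| ≤ (k.factorial : ℝ) * H (k + 1)) :
    ∀ k, k ≤ n → ∀ α, |iteratedDeriv k (fun t => Real.sin (f t + α)) t|
      ≤ (k.factorial : ℝ) * H k := by
  intro k
  induction k using Nat.strong_induction_on with
  | _ k ih =>
    intro hk α
    rcases k with _ | k
    · simp only [iteratedDeriv_zero, Nat.factorial_zero, Nat.cast_one, one_mul]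
      exact (Real.abs_sin_le_one _).trans H1
    · rw [ku_sin_succ hf]
      calc _ ≤ ∑ l ∈ Finset.range (k + 1), |(k.choose l : ℝ) * iteratedDeriv (l + 1) f t *
        iteratedDeriv (k - l) (fun t => Real.sin (f t + (α + Real.pi / 2))) t| :=
            Finset.abs_sum_le_sum_abs _ _
        _ ≤ ∑ l ∈ Finset.range (k + 1), (k.factorial : ℝ) * H (k + 1) := by
            refine Finset.sum_le_sum fun l hl => ?_
            rw [Finset.mem_range] at hl
            rw [abs_mul, abs_mul, abs_of_nonneg (by positivity : (0:ℝ) ≤ (k.choose l : ℝ))]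
            have a1 := hb l (by omega)
            have a2 := ih (k - l) (by omega) (by omega) (α + Real.pi / 2)
            have a3 := Hm (l + 1) (k - l)
            rw [show l + 1 + (k - l) = k + 1 by omega] at a3
            have a4 := H0 (l + 1)
            calc _ ≤ (k.choose l : ℝ) * ((l.factorial : ℝ) * H (l + 1)) *
                    (((k - l).factorial : ℝ) * H (k - l)) := by gcongr
              _ = ((k.choose l : ℝ) * ((l.factorial : ℝ) * ((k - l).factorial : ℝ))) *
                  (H (l + 1) * H (k - l)) := by ring
              _ ≤ _ := by rw [ku_fact k l (by omega)]; gcongr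
        _ = _ := by
            rw [Finset.sum_const, Finset.card_range, nsmul_eq_mul, Nat.factorial_succ]
            push_cast; ring

lemma ku_conv (d H : ℕ → ℝ) (hd : ∀ k, 0 ≤ d k) (Hm : ∀ a b, H a * H b ≤ H (a + b)) (k : ℕ) :
    ∑ l ∈ Finset.range (k + 1), (H (l + 1) * ∑ j ∈ Finset.range (k - l + 1), d j * H (k - l - j))
      + ∑ l ∈ Finset.range (k + 1), ((l : ℝ) + 1) * d (l + 1) * H (k - l)
    ≤ ((k : ℝ) + 1) * ∑ j ∈ Finset.range (k + 2), d j * H (k + 1 - j) := by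
  have A : ∑ l ∈ Finset.range (k + 1),
      (H (l + 1) * ∑ j ∈ Finset.range (k - l + 1), d j * H (k - l - j))
      ≤ ∑ j ∈ Finset.range (k + 1), ((k : ℝ) + 1 - j) * (d j * H (k + 1 - j)) := by
    calc _ = ∑ r ∈ Finset.range (k + 1),
      (H (k - r + 1) * ∑ j ∈ Finset.range (r + 1), d j * H (r - j)) := by
          rw [← Finset.sum_range_reflect]
          refine Finset.sum_congr rfl fun r hr => ?_
          rw [Finset.mem_range] at hr
          rw [show k - (k + 1 - 1 - r) = r by omega, show k + 1 - 1 - r = k - r by omega]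
      _ ≤ ∑ r ∈ Finset.range (k + 1), ∑ j ∈ Finset.range (r + 1), d j * H (k + 1 - j) := by
          refine Finset.sum_le_sum fun r hr => ?_
          rw [Finset.mul_sum]
          refine Finset.sum_le_sum fun j hj => ?_
          rw [Finset.mem_range] at hr hj
          have := Hm (k - r + 1) (r - j)
          rw [show k - r + 1 + (r - j) = k + 1 - j by omega] at this
          have := mul_le_mul_of_nonneg_left this (hd j)
          linarith
      _ = ∑ j ∈ Finset.range (k + 1), ∑ _i ∈ Finset.range (k + 1 - j), d j * H (k + 1 - j) :=
          Finset.sum_range_diag_flip (k + 1) (fun j _ => d j * H (k + 1 - j))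
      _ = _ := by
          refine Finset.sum_congr rfl fun j hj => ?_
          rw [Finset.mem_range] at hj
          rw [Finset.sum_const, Finset.card_range, nsmul_eq_mul, Nat.cast_sub (by omega)]
          push_cast; ring
  have B : ∑ l ∈ Finset.range (k + 1), ((l : ℝ) + 1) * d (l + 1) * H (k - l)
      = ∑ j ∈ Finset.range (k + 2), (j : ℝ) * (d j * H (k + 1 - j)) := by
    rw [Finset.sum_range_succ' _ (k + 1)]
    simp only [Nat.cast_zero, zero_mul, add_zero]
    refine Finset.sum_congr rfl fun j hj => ?_
    rw [show k + 1 - (j + 1) = k - j by omega]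
    push_cast; ring
  have C : ∑ j ∈ Finset.range (k + 1), ((k : ℝ) + 1 - j) * (d j * H (k + 1 - j))
      = ∑ j ∈ Finset.range (k + 2), ((k : ℝ) + 1 - j) * (d j * H (k + 1 - j)) := by
    rw [Finset.sum_range_succ _ (k + 1)]
    push_cast; ring
  rw [B]
  rw [C] at A
  calc _ ≤ ∑ j ∈ Finset.range (k + 2), ((k : ℝ) + 1 - j) * (d j * H (k + 1 - j)) +
        ∑ j ∈ Finset.range (k + 2), (j : ℝ) * (d j * H (k + 1 - j)) := by gcongr
    _ = _ := by
      rw [← Finset.sum_add_distrib, Finset.mul_sum]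
      refine Finset.sum_congr rfl fun j hj => ?_
      ring

lemma ku_diff_bound {Y X : ℝ → ℝ} (hY : ContDiff ℝ (⊤ : ℕ∞) Y) (hX : ContDiff ℝ (⊤ : ℕ∞) X)
    (t : ℝ) (H d : ℕ → ℝ) (hd : ∀ k, 0 ≤ d k)
    (H0 : ∀ k, 0 ≤ H k) (H1 : 1 ≤ H 0) (Hm : ∀ a b, H a * H b ≤ H (a + b)) (n : ℕ)
    (hbY : ∀ k, k < n → |iteratedDeriv (k + 1) Y t| ≤ (k.factorial : ℝ) * H (k + 1))
    (hbX : ∀ k, k < n → |iteratedDeriv (k + 1) X t| ≤ (k.factorial : ℝ) * H (k + 1))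
    (hbd : ∀ k, k ≤ n → |iteratedDeriv k Y t - iteratedDeriv k X t| ≤ (k.factorial : ℝ) * d k) :
    ∀ k, k ≤ n → ∀ α, |iteratedDeriv k (fun t => Real.sin (Y t + α)) t
        - iteratedDeriv k (fun t => Real.sin (X t + α)) t|
      ≤ (k.factorial : ℝ) * ∑ j ∈ Finset.range (k + 1), d j * H (k - j) := by
  intro k
  induction k using Nat.strong_induction_on with
  | _ k ih =>
    intro hk α
    rcases k with _ | k
    · have a1 := hbd 0 (Nat.zero_le _)
      simp only [iteratedDeriv_zero, Nat.factorial_zero, Nat.cast_one, one_mul] at a1 ⊢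
      simp only [zero_add, Finset.sum_range_one, Nat.sub_zero]
      have a2 : |Real.sin (Y t + α) - Real.sin (X t + α)| ≤ |Y t - X t| := by
        have := Real.abs_sin_sub_sin_le (Y t + α) (X t + α)
        simpa using this
      have := hd 0
      nlinarith
    · rw [ku_sin_succ hY, ku_sin_succ hX, ← Finset.sum_sub_distrib]
      calc _ ≤ ∑ l ∈ Finset.range (k + 1), _ := Finset.abs_sum_le_sum_abs _ _
        _ ≤ ∑ l ∈ Finset.range (k + 1), (k.factorial : ℝ) * (H (l + 1) *
              ∑ j ∈ Finset.range (k - l + 1), d j * H (k - l - j) +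
              ((l : ℝ) + 1) * d (l + 1) * H (k - l)) := by
            refine Finset.sum_le_sum fun l hl => ?_
            rw [Finset.mem_range] at hl
            have a1 := hbY l (by omega)
            have a2 := ih (k - l) (by omega) (by omega) (α + Real.pi / 2)
            have a3 := hbd (l + 1) (by omega)
            have a4 := ku_sin_bound hX t H H0 H1 Hm n hbX (k - l) (by omega) (α + Real.pi / 2)
            set y := iteratedDeriv (l + 1) Y t
            set x := iteratedDeriv (l + 1) X t
            set sy := iteratedDeriv (k - l) (fun t => Real.sin (Y t + (α + Real.pi / 2))) t
            set sx := iteratedDeriv (k - l) (fun t => Real.sin (X t + (α + Real.pi / 2))) t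
            set W := ∑ j ∈ Finset.range (k - l + 1), d j * H (k - l - j)
            have e1 : (k.choose l : ℝ) * y * sy - (k.choose l : ℝ) * x * sx
              = (k.choose l : ℝ) * (y * (sy - sx) + (y - x) * sx) := by ring
            rw [e1, abs_mul, abs_of_nonneg (by positivity : (0:ℝ) ≤ (k.choose l : ℝ))]
            have b1 := H0 (l + 1)
            have b2 := hd (l + 1)
            calc _ ≤ (k.choose l : ℝ) * (|y| * |sy - sx| + |y - x| * |sx|) := by
                  gcongr
                  refine (abs_add_le _ _).trans ?_
                  rw [abs_mul, abs_mul]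
              _ ≤ (k.choose l : ℝ) * ((l.factorial : ℝ) * H (l + 1) * (((k - l).factorial : ℝ) * W)
                  + ((l + 1).factorial : ℝ) * d (l + 1) * (((k - l).factorial : ℝ) * H (k - l))) := by
                  gcongr
              _ = ((k.choose l : ℝ) * ((l.factorial : ℝ) * ((k - l).factorial : ℝ))) *
                  (H (l + 1) * W + ((l : ℝ) + 1) * d (l + 1) * H (k - l)) := by
                  rw [Nat.factorial_succ]; push_cast; ring
              _ = _ := by rw [ku_fact k l (by omega)]
        _ ≤ _ := by
            rw [← Finset.mul_sum, Finset.sum_add_distrib, Nat.factorial_succ]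
            push_cast
            rw [mul_comm ((k:ℝ) + 1), mul_assoc]
            have := ku_conv d H hd Hm k
            gcongr

/-- `k`-th derivative of the coupling term -/
def kuS (N : ℕ) (κ : ℝ) (y : Fin N → ℝ → ℝ) (i : Fin N) (k : ℕ) (t : ℝ) : ℝ :=
  (κ / N) * ∑ j, iteratedDeriv k (fun s => Real.sin (y j s - y i s)) t

lemma ku_sinpair_smooth {N : ℕ} {y : Fin N → ℝ → ℝ} (hy : ∀ i, ContDiff ℝ (⊤ : ℕ∞) (y i))
    (i j : Fin N) : ContDiff ℝ (⊤ : ℕ∞) (fun s => Real.sin (y j s - y i s)) :=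
  Real.contDiff_sin.comp ((hy j).sub (hy i))

lemma ku_rhs_deriv {N : ℕ} (κ c : ℝ) {y : Fin N → ℝ → ℝ} (hy : ∀ i, ContDiff ℝ (⊤ : ℕ∞) (y i))
    (i : Fin N) (n : ℕ) (t : ℝ) :
    iteratedDeriv n (fun t => c + (κ / N) * ∑ j, Real.sin (y j t - y i t)) t
      = (if n = 0 then c else 0) + kuS N κ y i n t := by
  have h1 : iteratedDeriv n (fun t => (κ / N) * ∑ j, Real.sin (y j t - y i t)) t
      = kuS N κ y i n t := by
    rw [iteratedDeriv_const_mul_field, kuS,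
      iteratedDeriv_fun_sum (fun j _ => ku_at (ku_sinpair_smooth hy i j) n t)]
  rcases Nat.eq_zero_or_pos n with rfl | hn
  · simp [kuS]
  · rw [iteratedDeriv_const_add hn, h1, if_neg (by omega), zero_add]

lemma ku_rhs_smooth {N : ℕ} (κ c : ℝ) {y : Fin N → ℝ → ℝ} (hy : ∀ i, ContDiff ℝ (⊤ : ℕ∞) (y i))
    (i : Fin N) : ContDiff ℝ (⊤ : ℕ∞) (fun t => c + (κ / N) * ∑ j, Real.sin (y j t - y i t)) :=
  contDiff_const.add (contDiff_const.mul (ContDiff.sum fun j _ => ku_sinpair_smooth hy i j))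

lemma ku_ode_y {N : ℕ} {m κ : ℝ} {ν : Fin N → ℝ} {y : Fin N → ℝ → ℝ}
    (hy : ∀ i, ContDiff ℝ (⊤ : ℕ∞) (y i))
    (h : ∀ i, ∀ t : ℝ, 0 ≤ t →
    m * deriv (deriv (y i)) t + deriv (y i) t
      = ν i + (κ / N) * ∑ j, Real.sin (y j t - y i t)) (i : Fin N) (n : ℕ) (t : ℝ) (ht : 0 ≤ t) :
    m * iteratedDeriv (n + 2) (y i) t + iteratedDeriv (n + 1) (y i) t
      = (if n = 0 then ν i else 0) + kuS N κ y i n t := by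
  have s1 := ku_deriv_smooth (hy i)
  have s2 := ku_deriv_smooth s1
  rw [← ku_rhs_deriv κ (ν i) hy i n t,
    ← ku_eq_on ((contDiff_const.mul s2).add s1) (ku_rhs_smooth κ (ν i) hy i) (h i) n t ht]
  rw [iteratedDeriv_fun_add (ku_at (contDiff_const.mul s2) n t) (ku_at s1 n t),
    iteratedDeriv_const_mul_field, iteratedDeriv_succ', iteratedDeriv_succ', iteratedDeriv_succ']

lemma ku_ode_x {N : ℕ} {κ : ℝ} {ν : Fin N → ℝ} {x : Fin N → ℝ → ℝ}
    (hx : ∀ i, ContDiff ℝ (⊤ : ℕ∞) (x i))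
    (h : ∀ i, ∀ t : ℝ, 0 ≤ t → deriv (x i) t
      = ν i + (κ / N) * ∑ j, Real.sin (x j t - x i t)) (i : Fin N) (n : ℕ) (t : ℝ) (ht : 0 ≤ t) :
    iteratedDeriv (n + 1) (x i) t = (if n = 0 then ν i else 0) + kuS N κ x i n t := by
  rw [← ku_rhs_deriv κ (ν i) hx i n t,
    ← ku_eq_on (ku_deriv_smooth (hx i)) (ku_rhs_smooth κ (ν i) hx i) (h i) n t ht,
    iteratedDeriv_succ']

lemma ku_avg {N : ℕ} (hN : 1 ≤ N) {κ : ℝ} (hκ : 0 < κ) (b : Fin N → ℝ) (M : ℝ)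
    (h : ∀ j, |b j| ≤ M) : |(κ / N) * ∑ j, b j| ≤ κ * M := by
  have hN' : (0 : ℝ) < N := by exact_mod_cast hN
  rw [abs_mul, abs_of_pos (by positivity)]
  calc _ ≤ κ / N * ∑ _j : Fin N, M := by
        gcongr
        exact (Finset.abs_sum_le_sum_abs _ _).trans (Finset.sum_le_sum fun j _ => h j)
    _ = κ * M := by
        rw [Finset.sum_const, Finset.card_univ, Fintype.card_fin, nsmul_eq_mul]
        field_simp

lemma ku_S_zero {N : ℕ} (hN : 1 ≤ N) {κ : ℝ} (hκ : 0 < κ) (y : Fin N → ℝ → ℝ) (i : Fin N) (t : ℝ) :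
    |kuS N κ y i 0 t| ≤ κ := by
  have := ku_avg hN hκ (fun j => iteratedDeriv 0 (fun s => Real.sin (y j s - y i s)) t) 1
    (fun j => by simpa using Real.abs_sin_le_one _)
  simpa [kuS] using this

lemma ku_pair_deriv {N : ℕ} {y : Fin N → ℝ → ℝ} (hy : ∀ i, ContDiff ℝ (⊤ : ℕ∞) (y i))
    (i j : Fin N) (k : ℕ) (t : ℝ) :
    iteratedDeriv k (fun s => y j s - y i s) t
      = iteratedDeriv k (y j) t - iteratedDeriv k (y i) t :=
  iteratedDeriv_fun_sub (ku_at (hy j) k t) (ku_at (hy i) k t)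

lemma ku_S_bound {N : ℕ} (hN : 1 ≤ N) {κ : ℝ} (hκ : 0 < κ) {y : Fin N → ℝ → ℝ}
    (hy : ∀ i, ContDiff ℝ (⊤ : ℕ∞) (y i)) (t : ℝ) (H : ℕ → ℝ)
    (H0 : ∀ k, 0 ≤ H k) (H1 : 1 ≤ H 0) (Hm : ∀ a b, H a * H b ≤ H (a + b)) (n : ℕ)
    (hb : ∀ k, k < n → ∀ i j, |iteratedDeriv (k + 1) (y j) t - iteratedDeriv (k + 1) (y i) t|
      ≤ (k.factorial : ℝ) * H (k + 1)) (i : Fin N) :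
    |kuS N κ y i n t| ≤ κ * ((n.factorial : ℝ) * H n) := by
  apply ku_avg hN hκ
  intro j
  have := ku_sin_bound ((hy j).sub (hy i)) t H H0 H1 Hm n (fun k hk => by
    rw [ku_pair_deriv hy]; exact hb k hk i j) n le_rfl 0
  simpa using this

lemma ku_S_diff {N : ℕ} (hN : 1 ≤ N) {κ : ℝ} (hκ : 0 < κ) {y x : Fin N → ℝ → ℝ}
    (hy : ∀ i, ContDiff ℝ (⊤ : ℕ∞) (y i)) (hx : ∀ i, ContDiff ℝ (⊤ : ℕ∞) (x i))
    (t : ℝ) (H d : ℕ → ℝ) (hd : ∀ k, 0 ≤ d k)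
    (H0 : ∀ k, 0 ≤ H k) (H1 : 1 ≤ H 0) (Hm : ∀ a b, H a * H b ≤ H (a + b)) (n : ℕ)
    (hb : ∀ k, k < n → ∀ i j, |iteratedDeriv (k + 1) (y j) t - iteratedDeriv (k + 1) (y i) t|
      ≤ (k.factorial : ℝ) * H (k + 1))
    (hb' : ∀ k, k < n → ∀ i j, |iteratedDeriv (k + 1) (x j) t - iteratedDeriv (k + 1) (x i) t|
      ≤ (k.factorial : ℝ) * H (k + 1))
    (hbd : ∀ k, k ≤ n → ∀ i j, |(iteratedDeriv k (y j) t - iteratedDeriv k (x j) t)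
      - (iteratedDeriv k (y i) t - iteratedDeriv k (x i) t)| ≤ (k.factorial : ℝ) * d k)
    (i : Fin N) :
    |kuS N κ y i n t - kuS N κ x i n t|
      ≤ κ * ((n.factorial : ℝ) * ∑ j ∈ Finset.range (n + 1), d j * H (n - j)) := by
  rw [kuS, kuS, ← mul_sub, ← Finset.sum_sub_distrib]
  apply ku_avg hN hκ
  intro j
  have := ku_diff_bound ((hy j).sub (hy i)) ((hx j).sub (hx i)) t H d hd H0 H1 Hm n
    (fun k hk => by rw [ku_pair_deriv hy]; exact hb k hk i j)
    (fun k hk => by rw [ku_pair_deriv hx]; exact hb' k hk i j)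
    (fun k hk => by
      rw [ku_pair_deriv hy, ku_pair_deriv hx]
      have := hbd k hk i j
      rwa [show iteratedDeriv k (y j) t - iteratedDeriv k (y i) t
        - (iteratedDeriv k (x j) t - iteratedDeriv k (x i) t)
        = (iteratedDeriv k (y j) t - iteratedDeriv k (x j) t)
      - (iteratedDeriv k (y i) t - iteratedDeriv k (x i) t) by ring]) n le_rfl 0
  simpa using this

lemma ku_sin_two {f : ℝ → ℝ} (hf : ContDiff ℝ (⊤ : ℕ∞) f) (t a : ℝ)
    (h1 : |iteratedDeriv 1 f t| ≤ a) (h2 : |iteratedDeriv 2 f t| ≤ a ^ 2) :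
    |iteratedDeriv 2 (fun t => Real.sin (f t + 0)) t| ≤ 3 / 2 * a ^ 2 := by
  have e : iteratedDeriv 2 (fun t => Real.sin (f t + 0)) t
      = - (iteratedDeriv 1 f t) ^ 2 * Real.sin (f t) + iteratedDeriv 2 f t * Real.cos (f t) := by
    rw [ku_sin_succ hf 0 1 t, Finset.sum_range_succ, Finset.sum_range_one]
    simp only [Nat.sub_zero, Nat.sub_self]
    rw [ku_sin_succ hf _ 0 t, Finset.sum_range_one]
    simp only [Nat.sub_self, iteratedDeriv_zero, Nat.choose_self, Nat.choose_zero_right,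
      Nat.cast_one, one_mul, zero_add]
    rw [show f t + (Real.pi / 2 + Real.pi / 2) = f t + Real.pi by ring, Real.sin_add_pi,
      Real.sin_add_pi_div_two]
    norm_num
    ring
  rw [e]
  have hs := Real.sin_sq_add_cos_sq (f t)
  have h3 : |Real.sin (f t)| + |Real.cos (f t)| ≤ 3 / 2 := by
    rw [← sq_abs, ← sq_abs (Real.cos _)] at hs
    nlinarith [sq_nonneg (|Real.sin (f t)| - |Real.cos (f t)|), abs_nonneg (Real.sin (f t)),
      abs_nonneg (Real.cos (f t))]
  have h4 : (iteratedDeriv 1 f t) ^ 2 ≤ a ^ 2 := sq_le_sq' (abs_le.1 h1).1 (abs_le.1 h1).2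
  calc _ ≤ (iteratedDeriv 1 f t) ^ 2 * |Real.sin (f t)| + |iteratedDeriv 2 f t| * |Real.cos (f t)| := by
        refine (abs_add_le _ _).trans ?_
        rw [abs_mul, abs_mul, abs_neg, abs_of_nonneg (sq_nonneg _)]
    _ ≤ a ^ 2 * |Real.sin (f t)| + a ^ 2 * |Real.cos (f t)| := by gcongr
    _ ≤ _ := by nlinarith [sq_nonneg a]

lemma ku_S_two {N : ℕ} (hN : 1 ≤ N) {κ : ℝ} (hκ : 0 < κ) {y : Fin N → ℝ → ℝ}
    (hy : ∀ i, ContDiff ℝ (⊤ : ℕ∞) (y i)) (t a : ℝ)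
    (h1 : ∀ i j, |iteratedDeriv 1 (y j) t - iteratedDeriv 1 (y i) t| ≤ a)
    (h2 : ∀ i j, |iteratedDeriv 2 (y j) t - iteratedDeriv 2 (y i) t| ≤ a ^ 2) (i : Fin N) :
    |kuS N κ y i 2 t| ≤ κ * (3 / 2 * a ^ 2) := by
  apply ku_avg hN hκ
  intro j
  have := ku_sin_two ((hy j).sub (hy i)) t a (by rw [ku_pair_deriv hy]; exact h1 i j)
    (by rw [ku_pair_deriv hy]; exact h2 i j)
  simpa using this

/-- layer weights -/
def kuH (e u a : ℝ) (k : ℕ) : ℝ := e * u ^ k + (1 - e) * a ^ k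

lemma kuH_props {e u a : ℝ} (he : 0 ≤ e) (he1 : e ≤ 1) (ha : 0 ≤ a) (hau : a ≤ u) :
    (∀ k, 0 ≤ kuH e u a k) ∧ 1 ≤ kuH e u a 0 ∧
      (∀ k l, kuH e u a k * kuH e u a l ≤ kuH e u a (k + l)) ∧
      (∀ k, kuH e u a k ≤ u ^ k) ∧ (∀ k, a ^ k ≤ kuH e u a k) := by
  have hu : 0 ≤ u := ha.trans hau
  have h1 : 0 ≤ 1 - e := by linarith
  refine ⟨fun k => by unfold kuH; positivity, by simp [kuH], fun k l => ?_, fun k => ?_, fun k => ?_⟩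
  · unfold kuH
    have a1 : 0 ≤ u ^ k - a ^ k := sub_nonneg.2 (by gcongr)
    have a2 : 0 ≤ u ^ l - a ^ l := sub_nonneg.2 (by gcongr)
    have : 0 ≤ e * (1 - e) * ((u ^ k - a ^ k) * (u ^ l - a ^ l)) := by positivity
    rw [pow_add, pow_add]
    nlinarith
  · unfold kuH
    have a1 : 0 ≤ u ^ k - a ^ k := sub_nonneg.2 (by gcongr)
    nlinarith
  · unfold kuH
    have a1 : 0 ≤ u ^ k - a ^ k := sub_nonneg.2 (by gcongr)
    nlinarith

lemma ku_pow_props {a : ℝ} (ha : 0 ≤ a) :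
    (∀ k, 0 ≤ (fun k : ℕ => a ^ k) k) ∧ 1 ≤ (fun k : ℕ => a ^ k) 0 ∧
      (∀ k l, (fun k : ℕ => a ^ k) k * (fun k : ℕ => a ^ k) l ≤ (fun k : ℕ => a ^ k) (k + l)) :=
  ⟨fun k => by positivity, by simp, fun k l => by simp [pow_add]⟩

/-- difference majorants (normalized by `k!`) -/
def kuD (m κ a u e E : ℝ) (k : ℕ) : ℝ :=
  if k = 0 then m * a * (1 - e) * (2 * E - 1)
  else if k = 1 then e * a + 4 * κ * m * a * E * (1 - e)
  else u ^ k * e + 9 / 4 * m * κ * E * u ^ k * e + 3 / 2 * m * κ * E * (k + 1) * a ^ k * (1 - e)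

lemma kuD_nonneg {m κ a u e E : ℝ} (hm : 0 < m) (hκ : 0 < κ) (ha : 0 ≤ a) (hau : a ≤ u)
    (he : 0 ≤ e) (he1 : e ≤ 1) (hE : 1 ≤ E) (k : ℕ) : 0 ≤ kuD m κ a u e E k := by
  have hu : 0 ≤ u := ha.trans hau
  have h1 : 0 ≤ 1 - e := by linarith
  have h2 : 0 ≤ 2 * E - 1 := by linarith
  unfold kuD
  split_ifs <;> positivity

lemma ku_sum_aux (m E W V : ℝ) (r : ℕ) :
    ∑ j ∈ Finset.range r, (m * ((8 / 9 + 9 / 8 + 3 / 4 * ((j : ℝ) + 3)) * E * W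
          + 3 / 4 * ((j : ℝ) + 3) * E * V))
      = m * (((8 / 9 + 9 / 8) * r + 3 / 8 * ((r : ℝ) ^ 2 + 5 * r)) * E * W
          + 3 / 8 * ((r : ℝ) ^ 2 + 5 * r) * E * V) := by
  induction r with
  | zero => simp
  | succ r ih =>
    rw [Finset.sum_range_succ, ih]
    push_cast; ring

set_option maxHeartbeats 1000000 in
lemma ku_alg_sum {m κ a p u e E : ℝ} (hm : 0 < m) (hκ : 0 < κ) (hka : 2 * κ ≤ a) (hap : a ≤ p)
    (hpu : p ≤ u) (hpm : 9 / 8 ≤ p * m) (he : 0 ≤ e) (he1 : e ≤ 1) (hE : 1 ≤ E) (r : ℕ) :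
    ∑ k ∈ Finset.range (r + 2), kuD m κ a u e E k * kuH e u a (r + 1 - k)
      + m * ((r : ℝ) + 2) * (if r = 0 then 3 / 4 else 1) * a ^ (r + 2)
    ≤ m * (9 / 8 * ((r : ℝ) + 2) ^ 2 * E * (p * u ^ (r + 1) * e)
        + 3 / 4 * ((r : ℝ) + 2) * ((r : ℝ) + 3) * E * a ^ (r + 2)) := by
  have ha : 0 < a := by linarith
  have hp : 0 < p := by linarith
  have hu : 0 < u := by linarith
  have hφ : 0 ≤ 1 - e := by linarith
  have hφ1 : 1 - e ≤ 1 := by linarith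
  have hau : a ≤ u := hap.trans hpu
  have hE0 : 0 < E := by linarith
  obtain ⟨P0, P1, Pm, Pu, Pa⟩ := kuH_props he he1 ha.le hau
  set V := a ^ (r + 2) with hV
  have hV0 : 0 < V := by positivity
  set U := u ^ (r + 1) * e with hU
  have hU0 : 0 ≤ U := by positivity
  have hW0 : 0 ≤ p * U := by positivity
  have c1 : U ≤ m * (8 / 9 * E * (p * U)) := by
    have : U * 1 ≤ U * (8 / 9 * (p * m) * E) := by
      gcongr
      nlinarith
    linarith
  have c2 : κ * U ≤ p * U / 2 := by nlinarith
  have c3 : κ * a ^ (r + 1) ≤ V / 2 := by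
    rw [hV, pow_succ a (r + 1)]
    have : 0 < a ^ (r + 1) := by positivity
    nlinarith
  -- term 0
  have t0 : kuD m κ a u e E 0 * kuH e u a (r + 1) ≤ m * (2 * E * (p * U) + (2 * E - 1) * V) := by
    have : kuD m κ a u e E 0 * kuH e u a (r + 1)
        = m * ((1 - e) * (2 * E - 1) * (a * U) + (1 - e) ^ 2 * ((2 * E - 1) * V)) := by
      simp only [kuD, kuH, if_true, hU, hV]; ring
    rw [this]
    have h2 : 0 ≤ 2 * E - 1 := by linarith
    have d1 : (1 - e) * (2 * E - 1) * (a * U) ≤ 1 * (2 * E) * (p * U) := by gcongr; linarith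
    have d2 : (1 - e) ^ 2 * ((2 * E - 1) * V) ≤ 1 * ((2 * E - 1) * V) := by
      gcongr
      nlinarith
    exact mul_le_mul_of_nonneg_left (by linarith) hm.le
  -- general term
  have tk : ∀ j, j < r → kuD m κ a u e E (j + 2) * kuH e u a (r + 1 - (j + 2))
      ≤ m * ((8 / 9 + 9 / 8 + 3 / 4 * ((j : ℝ) + 3)) * E * (p * U)
          + 3 / 4 * ((j : ℝ) + 3) * E * V) := by
    intro j hj
    obtain ⟨l, hl⟩ : ∃ l, r + 1 = (j + 2) + l := ⟨r + 1 - (j + 2), by omega⟩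
    rw [show r + 1 - (j + 2) = l by omega]
    have b1 : u ^ (j + 2) * e * kuH e u a l ≤ U := by
      calc _ ≤ u ^ (j + 2) * e * u ^ l := by gcongr; exact Pu l
        _ = U := by rw [hU, hl, pow_add]; ring
    have b2 : a ^ (j + 2) * (1 - e) * kuH e u a l ≤ U + a ^ (r + 1) := by
      have : a ^ (j + 2) * (1 - e) * kuH e u a l
        = (1 - e) * (a ^ (j + 2) * u ^ l * e) + (1 - e) ^ 2 * a ^ (r + 1) := by
        rw [hl, pow_add, kuH]; ring
      rw [this]
      have d1 : (1 - e) * (a ^ (j + 2) * u ^ l * e) ≤ 1 * (u ^ (j + 2) * u ^ l * e) := by gcongr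
      have d2 : (1 - e) ^ 2 * a ^ (r + 1) ≤ 1 * a ^ (r + 1) := by
        gcongr
        nlinarith
      have d3 : U = u ^ (j + 2) * u ^ l * e := by rw [hU, hl, pow_add]
      linarith
    have e1 : kuD m κ a u e E (j + 2) * kuH e u a l
        = (u ^ (j + 2) * e * kuH e u a l) + 9 / 4 * m * E * (κ * (u ^ (j + 2) * e * kuH e u a l))
          + 3 / 2 * m * E * ((j : ℝ) + 3) * (κ * (a ^ (j + 2) * (1 - e) * kuH e u a l)) := by
      simp only [kuD]
      rw [if_neg (by omega), if_neg (by omega)]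
      push_cast; ring
    rw [e1]
    have b3 : κ * (u ^ (j + 2) * e * kuH e u a l) ≤ p * U / 2 :=
      (mul_le_mul_of_nonneg_left b1 hκ.le).trans c2
    have b4 : κ * (a ^ (j + 2) * (1 - e) * kuH e u a l) ≤ p * U / 2 + V / 2 := by
      have := mul_le_mul_of_nonneg_left b2 hκ.le
      linarith
    calc _ ≤ m * (8 / 9 * E * (p * U)) + 9 / 4 * m * E * (p * U / 2)
          + 3 / 2 * m * E * ((j : ℝ) + 3) * (p * U / 2 + V / 2) := by
          have := b1.trans c1
          gcongr
      _ = _ := by ring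
  have hsum : ∑ j ∈ Finset.range r, (m * ((8 / 9 + 9 / 8 + 3 / 4 * ((j : ℝ) + 3)) * E * (p * U)
          + 3 / 4 * ((j : ℝ) + 3) * E * V))
      = m * (((8 / 9 + 9 / 8) * r + 3 / 8 * ((r : ℝ) ^ 2 + 5 * r)) * E * (p * U)
          + 3 / 8 * ((r : ℝ) ^ 2 + 5 * r) * E * V) :=
    by exact ku_sum_aux m E (p * U) V r
  have hsplit : ∑ k ∈ Finset.range (r + 2), kuD m κ a u e E k * kuH e u a (r + 1 - k)
      = ∑ j ∈ Finset.range r, kuD m κ a u e E (j + 2) * kuH e u a (r + 1 - (j + 2))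
        + kuD m κ a u e E 1 * kuH e u a r + kuD m κ a u e E 0 * kuH e u a (r + 1) := by
    rw [Finset.sum_range_succ', Finset.sum_range_succ']
    simp
  have hle := Finset.sum_le_sum (fun j hj => tk j (Finset.mem_range.1 hj))
  rw [hsum] at hle
  rw [hsplit]
  have q1 : e * a * kuH e u a r ≤ U := by
    calc _ ≤ e * u * u ^ r := by
            have := P0 r
            have := Pu r
            gcongr
      _ = U := by rw [hU]; ring
  have q2 : 4 * κ * m * a * E * (1 - e) * kuH e u a r
      ≤ m * (2 * E * ((1 - e) * (a ^ 2 * kuH e u a r))) := by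
    have : 0 ≤ m * E * (1 - e) * a * kuH e u a r := by
      have := P0 r
      positivity
    nlinarith
  have q0 : kuD m κ a u e E 1 * kuH e u a r
      = e * a * kuH e u a r + 4 * κ * m * a * E * (1 - e) * kuH e u a r := by
    rw [kuD, if_neg (by omega), if_pos rfl]; ring
  rcases Nat.eq_zero_or_pos r with hr | hr
  · subst hr
    have hH : kuH e u a 0 = 1 := by simp [kuH]
    rw [hH] at q0 q1 q2
    have q3 : (1 - e) * (a ^ 2 * 1) ≤ V := by
      rw [hV]; simp only [zero_add]; nlinarith [sq_nonneg a]
    have q4 : m * (2 * E * ((1 - e) * (a ^ 2 * 1))) ≤ m * (2 * E * V) := by gcongr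
    have q5 : kuD m κ a u e E 1 * kuH e u a 0 ≤ m * (8 / 9 * E * (p * U) + 2 * E * V) := by
      rw [hH]; linarith
    simp only [Finset.range_zero, Finset.sum_empty, Nat.cast_zero, if_true]
    rw [Nat.zero_add] at t0
    clear_value U V
    have : m * (2 * E * (p * U) + (2 * E - 1) * V) + m * (8 / 9 * E * (p * U) + 2 * E * V)
        + m * (0 + 2) * (3 / 4) * V ≤
        m * (9 / 8 * (0 + 2) ^ 2 * E * (p * U) + 3 / 4 * (0 + 2) * (0 + 3) * E * V) := by
      have z1 : 0 ≤ m * (E * (p * U)) := by positivity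
      have z2 : 0 ≤ m * ((E - 1) * V) := mul_nonneg hm.le (mul_nonneg (by linarith) hV0.le)
      linarith
    have hUe : p * u ^ (0 + 1) * e = p * U := by rw [hU]; ring
    rw [hUe]
    simp only [Nat.zero_add] at *
    linarith
  · have q3 : (1 - e) * (a ^ 2 * kuH e u a r) ≤ p * U + V := by
      have : (1 - e) * (a ^ 2 * kuH e u a r)
        = (1 - e) * (a * a * (u ^ r * e)) + (1 - e) ^ 2 * V := by
        rw [hV, kuH]; ring
      rw [this]
      have d1 : (1 - e) * (a * a * (u ^ r * e)) ≤ 1 * (p * u * (u ^ r * e)) := by gcongr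
      have d2 : (1 - e) ^ 2 * V ≤ 1 * V := by
        gcongr
        nlinarith
      have d3 : p * U = p * u * (u ^ r * e) := by rw [hU]; ring
      linarith
    have q4 : m * (2 * E * ((1 - e) * (a ^ 2 * kuH e u a r))) ≤ m * (2 * E * (p * U + V)) := by
      gcongr
    have q5 : kuD m κ a u e E 1 * kuH e u a r
        ≤ m * (8 / 9 * E * (p * U) + 2 * E * (p * U + V)) := by
      linarith
    have hr1 : (1:ℝ) ≤ r := by exact_mod_cast hr
    rw [if_neg (by omega)]
    have hUe : p * u ^ (r + 1) * e = p * U := by rw [hU]; ring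
    rw [hUe]
    have k1 : (8 / 9 + 9 / 8) * (r : ℝ) + 3 / 8 * ((r : ℝ) ^ 2 + 5 * (r : ℝ)) + 8 / 9 + 4 ≤ 9 / 8 * ((r : ℝ) + 2) ^ 2 := by
      nlinarith
    have k2 : 3 / 8 * ((r : ℝ) ^ 2 + 5 * (r : ℝ)) + 5 + (r : ℝ) ≤ 3 / 4 * ((r : ℝ) + 2) * ((r : ℝ) + 3) := by
      nlinarith
    have k3 := mul_le_mul_of_nonneg_right k1 (by positivity : 0 ≤ m * (E * (p * U)))
    have k4 := mul_le_mul_of_nonneg_right k2 (by positivity : 0 ≤ m * (E * V))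
    have k5 : 0 ≤ m * ((E - 1) * (((r : ℝ) + 1) * V)) :=
      mul_nonneg hm.le (mul_nonneg (by linarith) (by positivity))
    linarith

/-- all hypotheses bundled -/
structure KuSys (N : ℕ) (m κ : ℝ) (ν ω0 : Fin N → ℝ) (y x : Fin N → ℝ → ℝ)
    (dW dV oW oV : ℝ) : Prop where
  hN : 1 ≤ N
  hm : 0 < m
  hκ : 0 < κ
  ysm : ∀ i, ContDiff ℝ (⊤ : ℕ∞) (y i)
  xsm : ∀ i, ContDiff ℝ (⊤ : ℕ∞) (x i)
  init : ∀ i, y i 0 = x i 0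
  vel : ∀ i, deriv (y i) 0 = ω0 i
  yode : ∀ i, ∀ t : ℝ, 0 ≤ t → m * deriv (deriv (y i)) t + deriv (y i) t
      = ν i + (κ / N) * ∑ j, Real.sin (y j t - y i t)
  xode : ∀ i, ∀ t : ℝ, 0 ≤ t → deriv (x i) t
      = ν i + (κ / N) * ∑ j, Real.sin (x j t - x i t)
  hdW : ∀ i j, |ω0 i - ω0 j| ≤ dW
  hdV : ∀ i j, |ν i - ν j| ≤ dV
  hoW : ∀ i, |ω0 i| ≤ oW
  hoV : ∀ i, |ν i| ≤ oV
  dW0 : 0 ≤ dW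
  dV0 : 0 ≤ dV
  oW0 : 0 ≤ oW
  oV0 : 0 ≤ oV

lemma ku_exp_deriv (m t : ℝ) :
    HasDerivAt (fun t => Real.exp (-t / m)) (-(Real.exp (-t / m)) / m) t := by
  have := ((hasDerivAt_neg t).div_const m).exp
  convert this using 1
  ring

lemma ku_exp2_deriv (κ t : ℝ) :
    HasDerivAt (fun t => Real.exp (2 * κ * t)) (2 * κ * Real.exp (2 * κ * t)) t := by
  have := ((hasDerivAt_id' t).const_mul (2 * κ)).exp
  convert this using 1
  ring

lemma ku_lin_deriv (m p : ℝ) (n : ℕ) (t : ℝ) :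
    HasDerivAt (fun t => (p * (1 + t / m)) ^ (n + 1))
      (((n : ℝ) + 1) * (p * (1 + t / m)) ^ n * (p / m)) t := by
  have := ((((hasDerivAt_id' t).div_const m).const_add 1).const_mul p).pow (n + 1)
  refine this.congr_deriv ?_
  rw [Nat.add_sub_cancel]
  push_cast
  ring

lemma ku_exp_le_one {m t : ℝ} (hm : 0 < m) (ht : 0 ≤ t) : Real.exp (-t / m) ≤ 1 := by
  rw [Real.exp_le_one_iff, neg_div]
  have : 0 ≤ t / m := by positivity
  linarith

lemma ku_one_le_exp {κ t : ℝ} (hκ : 0 < κ) (ht : 0 ≤ t) : 1 ≤ Real.exp (2 * κ * t) := by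
  rw [Real.one_le_exp_iff]; positivity

lemma ku_abs_sub (a b : ℝ) : |a - b| ≤ |a| + |b| := abs_sub _ _

namespace KuSys

variable {N : ℕ} {m κ : ℝ} {ν ω0 : Fin N → ℝ} {y x : Fin N → ℝ → ℝ} {dW dV oW oV : ℝ}

lemma oy (h : KuSys N m κ ν ω0 y x dW dV oW oV) (i : Fin N) (n : ℕ) (t : ℝ) (ht : 0 ≤ t) :
    m * iteratedDeriv (n + 2) (y i) t + iteratedDeriv (n + 1) (y i) t
      = (if n = 0 then ν i else 0) + kuS N κ y i n t :=
  ku_ode_y h.ysm h.yode i n t ht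

lemma ox (h : KuSys N m κ ν ω0 y x dW dV oW oV) (i : Fin N) (n : ℕ) (t : ℝ) (ht : 0 ≤ t) :
    iteratedDeriv (n + 1) (x i) t = (if n = 0 then ν i else 0) + kuS N κ x i n t :=
  ku_ode_x h.xsm h.xode i n t ht

/-- first-order model, pairwise -/
lemma xD (h : KuSys N m κ ν ω0 y x dW dV oW oV) {a : ℝ} (ha : a = 2 * κ + dW + dV)
    (t : ℝ) (ht : 0 ≤ t) (k : ℕ) : ∀ i j,
    |iteratedDeriv (k + 1) (x j) t - iteratedDeriv (k + 1) (x i) t|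
      ≤ (k.factorial : ℝ) * a ^ (k + 1) := by
  have hκ := h.hκ
  have hW := h.dW0
  have hV := h.dV0
  have ha0 : 0 < a := by rw [ha]; linarith
  induction k using Nat.strong_induction_on with
  | _ k ih =>
    intro i j
    rw [h.ox i k t ht, h.ox j k t ht]
    rcases k with _ | k
    · have a1 := abs_le.1 (ku_S_zero h.hN h.hκ x i t)
      have a2 := abs_le.1 (ku_S_zero h.hN h.hκ x j t)
      have a3 := abs_le.1 (h.hdV j i)
      simp only [if_true, Nat.factorial_zero, Nat.cast_one, one_mul, zero_add, pow_one]
      rw [abs_le]; constructor <;> linarith [a1.1, a1.2, a2.1, a2.2, a3.1, a3.2]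
    · obtain ⟨p1, p2, p3⟩ := ku_pow_props ha0.le
      have a1 := abs_le.1 (ku_S_bound h.hN h.hκ h.xsm t _ p1 p2 p3 (k + 1)
        (fun l hl i j => ih l hl i j) i)
      have a2 := abs_le.1 (ku_S_bound h.hN h.hκ h.xsm t _ p1 p2 p3 (k + 1)
        (fun l hl i j => ih l hl i j) j)
      simp only [Nat.succ_ne_zero, if_false, zero_add] at *
      have a3 : 2 * (κ * (((k + 1).factorial : ℝ) * a ^ (k + 1)))
          ≤ ((k + 1).factorial : ℝ) * a ^ (k + 1 + 1) := by
        rw [pow_succ a (k + 1)]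
        have : 0 < ((k + 1).factorial : ℝ) * a ^ (k + 1) := by positivity
        nlinarith
      rw [abs_le]; constructor <;> linarith [a1.1, a1.2, a2.1, a2.2]

lemma xsup (h : KuSys N m κ ν ω0 y x dW dV oW oV) {a : ℝ} (ha : a = 2 * κ + dW + dV)
    (t : ℝ) (ht : 0 ≤ t) (k : ℕ) (i : Fin N) :
    |iteratedDeriv (k + 2) (x i) t| ≤ κ * (((k + 1).factorial : ℝ) * a ^ (k + 1)) := by
  have hκ := h.hκ
  have hW := h.dW0
  have hV := h.dV0
  have ha0 : 0 < a := by rw [ha]; linarith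
  obtain ⟨p1, p2, p3⟩ := ku_pow_props ha0.le
  rw [h.ox i (k + 1) t ht]
  have := ku_S_bound h.hN h.hκ h.xsm t _ p1 p2 p3 (k + 1) (fun l hl i j => h.xD ha t ht l i j) i
  simpa using this

lemma xthree (h : KuSys N m κ ν ω0 y x dW dV oW oV) {a : ℝ} (ha : a = 2 * κ + dW + dV)
    (t : ℝ) (ht : 0 ≤ t) (r : ℕ) (i : Fin N) :
    |iteratedDeriv (r + 3) (x i) t|
      ≤ κ * (((r + 2).factorial : ℝ) * (if r = 0 then 3 / 4 else 1) * a ^ (r + 2)) := by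
  rcases r with _ | r
  · rw [h.ox i 2 t ht]
    have := ku_S_two h.hN h.hκ h.xsm t a
      (fun i j => by simpa using h.xD ha t ht 0 i j)
      (fun i j => by simpa using h.xD ha t ht 1 i j) i
    simp only [OfNat.ofNat_ne_zero, if_false, zero_add, if_true]
    refine this.trans (le_of_eq ?_)
    norm_num [Nat.factorial]
  · have := h.xsup ha t ht (r + 2) i
    simpa using this

lemma yD1 (h : KuSys N m κ ν ω0 y x dW dV oW oV) {a : ℝ} (ha : a = 2 * κ + dW + dV)
    (t : ℝ) (ht : 0 ≤ t) (i j : Fin N) :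
    |iteratedDeriv 1 (y j) t - iteratedDeriv 1 (y i) t| ≤ a := by
  have hκ := h.hκ
  have hW := h.dW0
  have hV := h.dV0
  refine ku_comp h.hm (fun t => iteratedDeriv 1 (y j) t - iteratedDeriv 1 (y i) t)
    (fun t => iteratedDeriv 2 (y j) t - iteratedDeriv 2 (y i) t) (fun _ => a) (fun _ => 0)
    (fun t => (ku_hasDerivAt (h.ysm j) 1 t).sub (ku_hasDerivAt (h.ysm i) 1 t))
    (fun t => hasDerivAt_const t a) ?_ ?_ t ht
  · simp only [iteratedDeriv_one, h.vel]
    exact (h.hdW j i).trans (by linarith)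
  · intro t ht
    have b1 := h.oy i 0 t ht
    have b2 := h.oy j 0 t ht
    simp only [if_true, zero_add] at b1 b2
    have a1 := abs_le.1 (ku_S_zero h.hN h.hκ y i t)
    have a2 := abs_le.1 (ku_S_zero h.hN h.hκ y j t)
    have a3 := abs_le.1 (h.hdV j i)
    rw [abs_le]; constructor <;> linarith [a1.1, a1.2, a2.1, a2.2, a3.1, a3.2]

lemma yinit2 (h : KuSys N m κ ν ω0 y x dW dV oW oV) {a : ℝ} (ha : a = 2 * κ + dW + dV)
    (i j : Fin N) :
    |iteratedDeriv 2 (y j) 0 - iteratedDeriv 2 (y i) 0| ≤ a / m := by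
  have hm := h.hm
  have b1 := h.oy i 0 0 le_rfl
  have b2 := h.oy j 0 0 le_rfl
  simp only [if_true, zero_add, iteratedDeriv_one, h.vel] at b1 b2
  have a1 := abs_le.1 (ku_S_zero h.hN h.hκ y i 0)
  have a2 := abs_le.1 (ku_S_zero h.hN h.hκ y j 0)
  have a3 := abs_le.1 (h.hdV j i)
  have a4 := abs_le.1 (h.hdW j i)
  rw [le_div_iff₀ hm, ← abs_of_pos hm, ← abs_mul]
  rw [abs_le]; constructor <;> linarith [a1.1, a1.2, a2.1, a2.2, a3.1, a3.2, a4.1, a4.2]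

lemma yinit (h : KuSys N m κ ν ω0 y x dW dV oW oV) {a p : ℝ} (ha : a = 2 * κ + dW + dV)
    (hap : a ≤ p) (hpm : 1 ≤ p * m) (k : ℕ) : ∀ i j,
    |iteratedDeriv (k + 1) (y j) 0 - iteratedDeriv (k + 1) (y i) 0|
      ≤ (k.factorial : ℝ) * p ^ (k + 1) := by
  have hm := h.hm
  have hκ := h.hκ
  have hW := h.dW0
  have hV := h.dV0
  have ha0 : 0 < a := by rw [ha]; linarith
  have hp0 : 0 < p := by linarith
  induction k using Nat.strong_induction_on with
  | _ k ih =>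
    intro i j
    rcases k with _ | _ | k
    · simpa using (h.yD1 ha 0 le_rfl i j).trans hap
    · refine (h.yinit2 ha i j).trans ?_
      rw [div_le_iff₀ hm]
      simp only [zero_add, Nat.factorial_one, Nat.cast_one, one_mul]
      calc a ≤ p * 1 := by linarith
        _ ≤ p * (p * m) := by gcongr
        _ = p ^ (1 + 1) * m := by ring
    · obtain ⟨p1, p2, p3⟩ := ku_pow_props hp0.le
      have a1 := abs_le.1 (ku_S_bound h.hN h.hκ h.ysm 0 _ p1 p2 p3 (k + 1)
        (fun l hl i j => ih l (by omega) i j) i)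
      have a2 := abs_le.1 (ku_S_bound h.hN h.hκ h.ysm 0 _ p1 p2 p3 (k + 1)
        (fun l hl i j => ih l (by omega) i j) j)
      have b1 := h.oy i (k + 1) 0 le_rfl
      have b2 := h.oy j (k + 1) 0 le_rfl
      simp only [Nat.succ_ne_zero, if_false, zero_add] at b1 b2
      have a3 := abs_le.1 (ih (k + 1) (by omega) i j)
      have a4 : 2 * (κ * (((k + 1).factorial : ℝ) * p ^ (k + 1)))
          ≤ ((k + 1).factorial : ℝ) * p ^ (k + 1 + 1) := by
        rw [pow_succ p (k + 1)]
        have : 0 < ((k + 1).factorial : ℝ) * p ^ (k + 1) := by positivity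
        nlinarith
      have a5 : |iteratedDeriv (k + 1 + 1 + 1) (y j) 0 - iteratedDeriv (k + 1 + 1 + 1) (y i) 0| * m
          ≤ 2 * (((k + 1).factorial : ℝ) * p ^ (k + 1 + 1)) := by
        rw [← abs_of_pos hm, ← abs_mul]
        rw [abs_le]; constructor <;> linarith [a1.1, a1.2, a2.1, a2.2, a3.1, a3.2]
      rw [← mul_le_mul_iff_left₀ hm]
      refine a5.trans ?_
      have e : ((k + 1 + 1).factorial : ℝ) * p ^ (k + 1 + 1 + 1) * m
        = (((k + 1).factorial : ℝ) * p ^ (k + 1 + 1)) * (((k : ℝ) + 2) * (p * m)) := by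
        rw [Nat.factorial_succ (k + 1)]; push_cast; ring
      rw [e, mul_comm 2]
      gcongr
      have : (0:ℝ) ≤ k := by positivity
      nlinarith

lemma yD (h : KuSys N m κ ν ω0 y x dW dV oW oV) {a p : ℝ} (ha : a = 2 * κ + dW + dV)
    (hap : a ≤ p) (hpm : 1 ≤ p * m) (k : ℕ) : ∀ t, 0 ≤ t → ∀ i j,
    |iteratedDeriv (k + 1) (y j) t - iteratedDeriv (k + 1) (y i) t|
      ≤ (k.factorial : ℝ) * kuH (Real.exp (-t / m)) (p * (1 + t / m)) a (k + 1) := by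
  have hm := h.hm
  have hκ := h.hκ
  have hW := h.dW0
  have hV := h.dV0
  have ha0 : 0 < a := by rw [ha]; linarith
  have hp0 : 0 < p := by linarith
  have hau : ∀ t, 0 ≤ t → a ≤ p * (1 + t / m) := fun t ht => by
    have : 0 ≤ p * (t / m) := by positivity
    linarith
  induction k using Nat.strong_induction_on with
  | _ k ih =>
    intro t ht i j
    rcases k with _ | k
    · obtain ⟨-, -, -, -, P⟩ := kuH_props (Real.exp_pos (-t / m)).le (ku_exp_le_one hm ht) ha0.le
        (hau t ht)
      have := P 1
      simp only [zero_add, Nat.factorial_zero, Nat.cast_one, one_mul]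
      refine (h.yD1 ha t ht i j).trans ?_
      linarith
    · have hB : ∀ t, HasDerivAt
        (fun t => ((k + 1).factorial : ℝ) *
          kuH (Real.exp (-t / m)) (p * (1 + t / m)) a (k + 1 + 1))
        (((k + 1).factorial : ℝ) * ((-(Real.exp (-t / m)) / m) * (p * (1 + t / m)) ^ (k + 1 + 1)
          + Real.exp (-t / m) * (((k + 1 : ℕ) + 1 : ℝ) * (p * (1 + t / m)) ^ (k + 1) * (p / m))
          + -(-(Real.exp (-t / m)) / m) * a ^ (k + 1 + 1))) t := by
        intro t
        have e1 := ku_exp_deriv m t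
        exact ((e1.mul (ku_lin_deriv m p (k + 1) t)).add
          ((e1.const_sub 1).mul_const _)).const_mul _
      refine ku_comp h.hm
        (fun t => iteratedDeriv (k + 1 + 1) (y j) t - iteratedDeriv (k + 1 + 1) (y i) t)
        (fun t => iteratedDeriv (k + 1 + 2) (y j) t - iteratedDeriv (k + 1 + 2) (y i) t) _ _
        (fun t => (ku_hasDerivAt (h.ysm j) _ t).sub (ku_hasDerivAt (h.ysm i) _ t)) hB ?_ ?_ t ht
      · have := h.yinit ha hap hpm (k + 1) i j
        simpa [kuH] using this
      · intro t ht
        obtain ⟨P0, P1, Pm, Pu, Pa⟩ := kuH_props (Real.exp_pos (-t / m)).le (ku_exp_le_one hm ht)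
          ha0.le (hau t ht)
        have b1 := h.oy i (k + 1) t ht
        have b2 := h.oy j (k + 1) t ht
        simp only [Nat.succ_ne_zero, if_false, zero_add] at b1 b2
        have a1 := abs_le.1 (ku_S_bound h.hN h.hκ h.ysm t _ P0 P1 Pm (k + 1)
          (fun l hl i j => ih l (by omega) t ht i j) i)
        have a2 := abs_le.1 (ku_S_bound h.hN h.hκ h.ysm t _ P0 P1 Pm (k + 1)
          (fun l hl i j => ih l (by omega) t ht i j) j)
        have hu := hau t ht
        have he0 := Real.exp_pos (-t / m)
        have he1 := ku_exp_le_one hm ht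
        simp only [kuH] at a1 a2 ⊢
        have hpu : p ≤ p * (1 + t / m) := by
          have : 0 ≤ p * (t / m) := by positivity
          linarith
        generalize hT : p * (1 + t / m) = u at *
        generalize Real.exp (-t / m) = e at *
        have hmul : m * (((k + 1).factorial : ℝ) * (-e / m * u ^ (k + 1 + 1) +
            e * (((k + 1 : ℕ) + 1 : ℝ) * u ^ (k + 1) * (p / m)) + -(-e / m) * a ^ (k + 1 + 1))) +
            ((k + 1).factorial : ℝ) * (e * u ^ (k + 1 + 1) + (1 - e) * a ^ (k + 1 + 1))
            = ((k + 1).factorial : ℝ) * (e * (((k : ℝ) + 2) * u ^ (k + 1) * p) + a ^ (k + 1 + 1)) := by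
          push_cast
          field_simp
          ring
        rw [hmul]
        have hu0 : 0 < u := by linarith
        have key : 2 * (κ * (((k + 1).factorial : ℝ) * (e * u ^ (k + 1) + (1 - e) * a ^ (k + 1))))
          ≤ ((k + 1).factorial : ℝ) * (e * (((k : ℝ) + 2) * u ^ (k + 1) * p) + a ^ (k + 1 + 1)) := by
          have q1 : 2 * κ * (e * u ^ (k + 1)) ≤ e * (((k : ℝ) + 2) * u ^ (k + 1) * p) := by
            have : 2 * κ * (e * u ^ (k + 1)) ≤ (((k : ℝ) + 2) * p) * (e * u ^ (k + 1)) := by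
              gcongr
              · have : (0:ℝ) ≤ k := by positivity
                linarith
              · linarith
            linarith
          have q2 : 2 * κ * ((1 - e) * a ^ (k + 1)) ≤ a ^ (k + 1 + 1) := by
            have h1e : 0 ≤ 1 - e := by linarith
            calc 2 * κ * ((1 - e) * a ^ (k + 1)) ≤ a * (1 * a ^ (k + 1)) := by
                  gcongr <;> linarith
              _ = _ := by ring
          have q3 : 2 * κ * (e * u ^ (k + 1)) + 2 * κ * ((1 - e) * a ^ (k + 1))
            ≤ e * (((k : ℝ) + 2) * u ^ (k + 1) * p) + a ^ (k + 1 + 1) := add_le_add q1 q2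
          have := mul_le_mul_of_nonneg_left q3 (by positivity : 0 ≤ ((k + 1).factorial : ℝ))
          linarith
        rw [abs_le]; constructor <;> linarith [a1.1, a1.2, a2.1, a2.2]

end KuSys

/-- one comparison step for derivatives of order `r + 2` -/
lemma ku_step {m κ a p : ℝ} (hm : 0 < m) (hκ : 0 < κ) (hka : 2 * κ ≤ a) (hap : a ≤ p)
    (hpm : 9 / 8 ≤ p * m) (r : ℕ) (K c0 : ℝ) (hK : 0 ≤ K) (f f' : ℝ → ℝ)
    (hf : ∀ t, HasDerivAt f (f' t) t)
    (h0 : |f 0| ≤ c0 + K * (9 / 8 * m * κ * ((r + 2).factorial : ℝ) * p ^ (r + 2)))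
    (h : ∀ t, 0 ≤ t → |m * f' t + f t| ≤ K * (κ * (((r + 1).factorial : ℝ) *
        ∑ k ∈ Finset.range (r + 1 + 1),
          kuD m κ a (p * (1 + t / m)) (Real.exp (-t / m)) (Real.exp (2 * κ * t)) k *
          kuH (Real.exp (-t / m)) (p * (1 + t / m)) a (r + 1 - k))
      + m * (κ * (((r + 2).factorial : ℝ) * (if r = 0 then 3 / 4 else 1) * a ^ (r + 2))))) :
    ∀ t, 0 ≤ t → |f t| ≤ c0 * Real.exp (-t / m) + K * (9 / 8 * m * κ * ((r + 2).factorial : ℝ) *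
        (Real.exp (2 * κ * t) * (p * (1 + t / m)) ^ (r + 1 + 1) * Real.exp (-t / m))
      + 3 / 4 * m * κ * ((r + 3).factorial : ℝ) * a ^ (r + 2) *
        (Real.exp (2 * κ * t) * (1 - Real.exp (-t / m)))) := by
  have hB : ∀ t, HasDerivAt (fun t => c0 * Real.exp (-t / m) +
      K * (9 / 8 * m * κ * ((r + 2).factorial : ℝ) *
        (Real.exp (2 * κ * t) * (p * (1 + t / m)) ^ (r + 1 + 1) * Real.exp (-t / m))
      + 3 / 4 * m * κ * ((r + 3).factorial : ℝ) * a ^ (r + 2) *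
        (Real.exp (2 * κ * t) * (1 - Real.exp (-t / m)))))
      (c0 * (-(Real.exp (-t / m)) / m) + K * (9 / 8 * m * κ * ((r + 2).factorial : ℝ) *
        ((2 * κ * Real.exp (2 * κ * t) * (p * (1 + t / m)) ^ (r + 1 + 1)
          + Real.exp (2 * κ * t) * (((r + 1 : ℕ) + 1 : ℝ) * (p * (1 + t / m)) ^ (r + 1) * (p / m)))
            * Real.exp (-t / m)
          + Real.exp (2 * κ * t) * (p * (1 + t / m)) ^ (r + 1 + 1) * (-(Real.exp (-t / m)) / m))
      + 3 / 4 * m * κ * ((r + 3).factorial : ℝ) * a ^ (r + 2) *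
        (2 * κ * Real.exp (2 * κ * t) * (1 - Real.exp (-t / m))
          + Real.exp (2 * κ * t) * (-(-(Real.exp (-t / m)) / m))))) t := by
    intro t
    have e1 := ku_exp_deriv m t
    have e2 := ku_exp2_deriv κ t
    have e3 := ku_lin_deriv m p (r + 1) t
    exact (e1.const_mul c0).add (((((e2.mul e3).mul e1).const_mul _).add
      ((e2.mul (e1.const_sub 1)).const_mul _)).const_mul K)
  refine ku_comp hm f f' _ _ hf hB ?_ ?_
  · refine h0.trans (le_of_eq ?_)
    simp
  · intro t ht
    refine (h t ht).trans ?_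
    have he0 := Real.exp_pos (-t / m)
    have he1 := ku_exp_le_one hm ht
    have hE := ku_one_le_exp hκ ht
    have hp : 0 < p := by linarith
    have hpu : p ≤ p * (1 + t / m) := by
      have : 0 ≤ p * (t / m) := by positivity
      linarith
    generalize p * (1 + t / m) = u at *
    generalize Real.exp (-t / m) = e at *
    generalize Real.exp (2 * κ * t) = E at *
    have A := ku_alg_sum hm hκ hka hap hpu hpm he0.le he1 hE r
    have f2 : ((r + 2).factorial : ℝ) = ((r : ℝ) + 2) * ((r + 1).factorial : ℝ) := by
      rw [Nat.factorial_succ (r + 1)]; push_cast; ring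
    have f3 : ((r + 3).factorial : ℝ) = ((r : ℝ) + 3) * (((r : ℝ) + 2) * ((r + 1).factorial : ℝ)) := by
      rw [Nat.factorial_succ (r + 2), Nat.factorial_succ (r + 1)]; push_cast; ring
    rw [f2, f3]
    have hF : 0 < ((r + 1).factorial : ℝ) := by positivity
    generalize ((r + 1).factorial : ℝ) = F at *
    generalize (if r = 0 then (3 / 4 : ℝ) else 1) = X at *
    generalize ∑ k ∈ Finset.range (r + 2), kuD m κ a u e E k * kuH e u a (r + 1 - k) = S at *
    have hu : 0 < u := by linarith
    have ha : 0 < a := by linarith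
    have h1e : 0 ≤ 1 - e := by linarith
    have A2 := mul_le_mul_of_nonneg_left A (by positivity : 0 ≤ K * (κ * F))
    have hee : m * (c0 * (-e / m) + K * (9 / 8 * m * κ * ((r + 2) * F) *
        ((2 * κ * E * u ^ (r + 1 + 1)
          + E * (((r + 1 : ℕ) + 1 : ℝ) * u ^ (r + 1) * (p / m))) * e
          + E * u ^ (r + 1 + 1) * (-e / m))
      + 3 / 4 * m * κ * ((r + 3) * ((r + 2) * F)) * a ^ (r + 2) *
        (2 * κ * E * (1 - e) + E * (-(-e / m))))) +
        (c0 * e + K * (9 / 8 * m * κ * ((r + 2) * F) * (E * u ^ (r + 1 + 1) * e)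
          + 3 / 4 * m * κ * ((r + 3) * ((r + 2) * F)) * a ^ (r + 2) * (E * (1 - e))))
        = K * (κ * F) * (m * (9 / 8 * ((r : ℝ) + 2) ^ 2 * E * (p * u ^ (r + 1) * e)
        + 3 / 4 * ((r : ℝ) + 2) * ((r : ℝ) + 3) * E * a ^ (r + 2)))
        + K * (9 / 8 * m * κ * ((r + 2) * F) * (2 * κ * m * E * u ^ (r + 2) * e)
          + 3 / 4 * m * κ * ((r + 3) * ((r + 2) * F)) * a ^ (r + 2) * (2 * κ * m * E * (1 - e))) := by
      push_cast
      field_simp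
      ring
    rw [hee]
    have pos : 0 ≤ K * (9 / 8 * m * κ * ((r + 2) * F) * (2 * κ * m * E * u ^ (r + 2) * e)
          + 3 / 4 * m * κ * ((r + 3) * ((r + 2) * F)) * a ^ (r + 2) * (2 * κ * m * E * (1 - e))) := by
      positivity
    linarith

namespace KuSys

variable {N : ℕ} {m κ : ℝ} {ν ω0 : Fin N → ℝ} {y x : Fin N → ℝ → ℝ} {dW dV oW oV : ℝ}

lemma yD2 (h : KuSys N m κ ν ω0 y x dW dV oW oV) {a : ℝ} (ha : a = 2 * κ + dW + dV)
    (t : ℝ) (ht : 0 ≤ t) (i j : Fin N) :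
    |iteratedDeriv 2 (y j) t - iteratedDeriv 2 (y i) t|
      ≤ a / m * Real.exp (-t / m) + 2 * κ * a * (1 - Real.exp (-t / m)) := by
  have hm := h.hm
  have hκ := h.hκ
  have hW := h.dW0
  have hV := h.dV0
  have ha0 : 0 < a := by rw [ha]; linarith
  refine ku_comp h.hm (fun t => iteratedDeriv 2 (y j) t - iteratedDeriv 2 (y i) t)
    (fun t => iteratedDeriv 3 (y j) t - iteratedDeriv 3 (y i) t)
    (fun t => a / m * Real.exp (-t / m) + 2 * κ * a * (1 - Real.exp (-t / m)))
    (fun t => a / m * (-(Real.exp (-t / m)) / m) + 2 * κ * a * (-(-(Real.exp (-t / m)) / m)))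
    (fun t => (ku_hasDerivAt (h.ysm j) 2 t).sub (ku_hasDerivAt (h.ysm i) 2 t))
    (fun t => ((ku_exp_deriv m t).const_mul _).add (((ku_exp_deriv m t).const_sub 1).const_mul _))
    ?_ ?_ t ht
  · simpa using h.yinit2 ha i j
  · intro t ht
    have b1 := h.oy i 1 t ht
    have b2 := h.oy j 1 t ht
    simp only [one_ne_zero, if_false, zero_add, Nat.reduceAdd] at b1 b2
    obtain ⟨p1, p2, p3⟩ := ku_pow_props ha0.le
    have hb : ∀ k, k < 1 → ∀ i j, |iteratedDeriv (k + 1) (y j) t - iteratedDeriv (k + 1) (y i) t|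
      ≤ (k.factorial : ℝ) * a ^ (k + 1) := by
      intro k hk i j
      obtain rfl : k = 0 := by omega
      simpa using h.yD1 ha t ht i j
    have a1 := abs_le.1 (ku_S_bound h.hN h.hκ h.ysm t _ p1 p2 p3 1 hb i)
    have a2 := abs_le.1 (ku_S_bound h.hN h.hκ h.ysm t _ p1 p2 p3 1 hb j)
    simp only [Nat.factorial_one, Nat.cast_one, one_mul, pow_one] at a1 a2
    have e : m * (a / m * (-(Real.exp (-t / m)) / m) + 2 * κ * a * (-(-(Real.exp (-t / m)) / m)))
      + (a / m * Real.exp (-t / m) + 2 * κ * a * (1 - Real.exp (-t / m))) = 2 * κ * a := by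
      field_simp
      ring
    rw [e, abs_le]; constructor <;> linarith [a1.1, a1.2, a2.1, a2.2]

lemma dD0 (h : KuSys N m κ ν ω0 y x dW dV oW oV) {a : ℝ} (ha : a = 2 * κ + dW + dV)
    (t : ℝ) (ht : 0 ≤ t) (i j : Fin N) :
    |(iteratedDeriv 0 (y j) t - iteratedDeriv 0 (x j) t)
      - (iteratedDeriv 0 (y i) t - iteratedDeriv 0 (x i) t)|
      ≤ m * a * (1 - Real.exp (-t / m)) * (2 * Real.exp (2 * κ * t) - 1) := by
  have hm := h.hm
  have hκ := h.hκ
  have hW := h.dW0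
  have hV := h.dV0
  have ha0 : 0 < a := by rw [ha]; linarith
  have : Nonempty (Fin N × Fin N) := ⟨(i, j)⟩
  refine ku_gron (ι := Fin N × Fin N)
    (fun q t => (iteratedDeriv 0 (y q.2) t - iteratedDeriv 0 (x q.2) t)
      - (iteratedDeriv 0 (y q.1) t - iteratedDeriv 0 (x q.1) t))
    (fun q t => (iteratedDeriv 1 (y q.2) t - iteratedDeriv 1 (x q.2) t)
      - (iteratedDeriv 1 (y q.1) t - iteratedDeriv 1 (x q.1) t))
    (fun q t => ((ku_hasDerivAt (h.ysm q.2) 0 t).sub (ku_hasDerivAt (h.xsm q.2) 0 t)).sub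
      ((ku_hasDerivAt (h.ysm q.1) 0 t).sub (ku_hasDerivAt (h.xsm q.1) 0 t)))
    (fun t => m * a * (1 - Real.exp (-t / m)) * (2 * Real.exp (2 * κ * t) - 1))
    (fun t => m * a * (-(-(Real.exp (-t / m)) / m)) * (2 * Real.exp (2 * κ * t) - 1)
      + m * a * (1 - Real.exp (-t / m)) * (2 * (2 * κ * Real.exp (2 * κ * t))))
    (fun t => a * Real.exp (-t / m) + 2 * κ * m * a * (1 - Real.exp (-t / m)))
    (fun t => (((ku_exp_deriv m t).const_sub 1).const_mul _).mul
      (((ku_exp2_deriv κ t).const_mul 2).sub_const 1))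
    (2 * κ) ?_ ?_ ?_ t ht (i, j)
  · intro q
    simp [h.init]
  · rintro t ht M hM ⟨i, j⟩
    have hM0 : 0 ≤ M := (abs_nonneg _).trans (hM (i, j))
    obtain ⟨p1, p2, p3⟩ := ku_pow_props ha0.le
    have D := ku_S_diff h.hN h.hκ h.ysm h.xsm t (fun k => a ^ k) (fun _ => M) (fun _ => hM0)
      p1 p2 p3 0 (fun k hk => by omega) (fun k hk => by omega)
      (fun k hk i j => by
        obtain rfl : k = 0 := by omega
        simpa using hM (i, j))
    have D1 := abs_le.1 (D i)
    have D2 := abs_le.1 (D j)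
    simp only [Nat.factorial_zero, Nat.cast_one, one_mul, zero_add, Finset.sum_range_one,
      Nat.sub_zero, pow_zero, mul_one] at D1 D2
    have b1 := h.oy i 0 t ht
    have b2 := h.oy j 0 t ht
    have c1 := h.ox i 0 t ht
    have c2 := h.ox j 0 t ht
    simp only [if_true, zero_add] at b1 b2 c1 c2
    have Y := mul_le_mul_of_nonneg_left (h.yD2 ha t ht i j) hm.le
    have e : m * (a / m * Real.exp (-t / m) + 2 * κ * a * (1 - Real.exp (-t / m)))
      = a * Real.exp (-t / m) + 2 * κ * m * a * (1 - Real.exp (-t / m)) := by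
      field_simp
    rw [e, ← abs_of_pos hm, ← abs_mul, abs_of_pos hm] at Y
    have Y' := abs_le.1 Y
    rw [abs_le]; constructor <;> linarith [D1.1, D1.2, D2.1, D2.2, Y'.1, Y'.2]
  · intro t ht
    have he0 := Real.exp_pos (-t / m)
    have hE := ku_one_le_exp hκ ht
    generalize Real.exp (-t / m) = e at *
    generalize Real.exp (2 * κ * t) = E at *
    have e1 : m * a * (-(-e / m)) * (2 * E - 1) = a * e * (2 * E - 1) := by
      field_simp
    rw [e1]
    have : 0 ≤ a * e * (E - 1) := mul_nonneg (by positivity) (by linarith)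
    nlinarith

lemma dD1 (h : KuSys N m κ ν ω0 y x dW dV oW oV) {a : ℝ} (ha : a = 2 * κ + dW + dV)
    (t : ℝ) (ht : 0 ≤ t) (i j : Fin N) :
    |(iteratedDeriv 1 (y j) t - iteratedDeriv 1 (x j) t)
      - (iteratedDeriv 1 (y i) t - iteratedDeriv 1 (x i) t)|
      ≤ Real.exp (-t / m) * a
        + 4 * κ * m * a * Real.exp (2 * κ * t) * (1 - Real.exp (-t / m)) := by
  have hm := h.hm
  have hκ := h.hκ
  have hW := h.dW0
  have hV := h.dV0
  have ha0 : 0 < a := by rw [ha]; linarith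
  refine ku_comp h.hm
    (fun t => (iteratedDeriv 1 (y j) t - iteratedDeriv 1 (x j) t)
      - (iteratedDeriv 1 (y i) t - iteratedDeriv 1 (x i) t))
    (fun t => (iteratedDeriv 2 (y j) t - iteratedDeriv 2 (x j) t)
      - (iteratedDeriv 2 (y i) t - iteratedDeriv 2 (x i) t))
    (fun t => Real.exp (-t / m) * a
        + 4 * κ * m * a * Real.exp (2 * κ * t) * (1 - Real.exp (-t / m)))
    (fun t => -(Real.exp (-t / m)) / m * a
        + (4 * κ * m * a * (2 * κ * Real.exp (2 * κ * t)) * (1 - Real.exp (-t / m))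
          + 4 * κ * m * a * Real.exp (2 * κ * t) * (-(-(Real.exp (-t / m)) / m))))
    (fun t => ((ku_hasDerivAt (h.ysm j) 1 t).sub (ku_hasDerivAt (h.xsm j) 1 t)).sub
      ((ku_hasDerivAt (h.ysm i) 1 t).sub (ku_hasDerivAt (h.xsm i) 1 t)))
    (fun t => ((ku_exp_deriv m t).mul_const a).add
      (((ku_exp2_deriv κ t).const_mul _).mul ((ku_exp_deriv m t).const_sub 1)))
    ?_ ?_ t ht
  · have c1 := h.ox i 0 0 le_rfl
    have c2 := h.ox j 0 0 le_rfl
    simp only [if_true, zero_add] at c1 c2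
    have v1 : iteratedDeriv 1 (y i) 0 = ω0 i := by rw [iteratedDeriv_one, h.vel]
    have v2 : iteratedDeriv 1 (y j) 0 = ω0 j := by rw [iteratedDeriv_one, h.vel]
    have a1 := abs_le.1 (ku_S_zero h.hN h.hκ x i 0)
    have a2 := abs_le.1 (ku_S_zero h.hN h.hκ x j 0)
    have a3 := abs_le.1 (h.hdV j i)
    have a4 := abs_le.1 (h.hdW j i)
    rw [c1, c2, v1, v2]
    simp only [neg_zero, zero_div, Real.exp_zero, sub_self, mul_zero, add_zero, one_mul]
    rw [abs_le]; constructor <;> linarith [a1.1, a1.2, a2.1, a2.2, a3.1, a3.2, a4.1, a4.2]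
  · intro t ht
    have he0 := Real.exp_pos (-t / m)
    have he1 := ku_exp_le_one hm ht
    have hE := ku_one_le_exp hκ ht
    have Z := fun i j => h.dD0 ha t ht i j
    obtain ⟨p1, p2, p3⟩ := ku_pow_props ha0.le
    have D := ku_S_diff h.hN h.hκ h.ysm h.xsm t (fun k => a ^ k)
      (fun _ => m * a * (1 - Real.exp (-t / m)) * (2 * Real.exp (2 * κ * t) - 1))
      (fun _ => (abs_nonneg _).trans (Z i j))
      p1 p2 p3 0 (fun k hk => by omega) (fun k hk => by omega)
      (fun k hk i j => by
        obtain rfl : k = 0 := by omega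
        simpa using Z i j)
    have D1 := abs_le.1 (D i)
    have D2 := abs_le.1 (D j)
    simp only [Nat.factorial_zero, Nat.cast_one, one_mul, zero_add, Finset.sum_range_one,
      Nat.sub_zero, pow_zero, mul_one] at D1 D2
    have b1 := h.oy i 0 t ht
    have b2 := h.oy j 0 t ht
    have c1 := h.ox i 0 t ht
    have c2 := h.ox j 0 t ht
    simp only [if_true, zero_add] at b1 b2 c1 c2
    have X1 := mul_le_mul_of_nonneg_left (h.xsup ha t ht 0 i) hm.le
    have X2 := mul_le_mul_of_nonneg_left (h.xsup ha t ht 0 j) hm.le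
    rw [← abs_of_pos hm, ← abs_mul, abs_of_pos hm] at X1 X2
    have X1' := abs_le.1 X1
    have X2' := abs_le.1 X2
    simp only [zero_add, Nat.factorial_one, Nat.cast_one, one_mul, pow_one] at X1' X2'
    generalize Real.exp (-t / m) = e at *
    generalize Real.exp (2 * κ * t) = E at *
    have e1 : m * (-e / m * a + (4 * κ * m * a * (2 * κ * E) * (1 - e)
          + 4 * κ * m * a * E * (-(-e / m)))) + (e * a + 4 * κ * m * a * E * (1 - e))
        = 8 * κ ^ 2 * m ^ 2 * a * (E * (1 - e)) + 4 * κ * m * a * E := by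
      field_simp
      ring
    have q1 : m * a * (1 - e) * (2 * E - 1) ≤ m * a * 1 * (2 * E - 1) := by
      gcongr
      · linarith
      · linarith
    have q2 := mul_le_mul_of_nonneg_left q1 hκ.le
    have q3 : 0 ≤ 8 * κ ^ 2 * m ^ 2 * a * (E * (1 - e)) :=
      mul_nonneg (by positivity) (mul_nonneg (by linarith) (by linarith))
    rw [e1, abs_le]
    constructor <;> linarith [D1.1, D1.2, D2.1, D2.2, X1'.1, X1'.2, X2'.1, X2'.2]

lemma eqn (h : KuSys N m κ ν ω0 y x dW dV oW oV) {a p : ℝ} (ha : a = 2 * κ + dW + dV)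
    (hap : a ≤ p) (hpm : 1 ≤ p * m) (t : ℝ) (ht : 0 ≤ t) (r : ℕ)
    (hd : ∀ k, k ≤ r + 1 → ∀ i j, |(iteratedDeriv k (y j) t - iteratedDeriv k (x j) t)
      - (iteratedDeriv k (y i) t - iteratedDeriv k (x i) t)| ≤ (k.factorial : ℝ) *
        kuD m κ a (p * (1 + t / m)) (Real.exp (-t / m)) (Real.exp (2 * κ * t)) k) (i : Fin N) :
    |m * (iteratedDeriv (r + 3) (y i) t - iteratedDeriv (r + 3) (x i) t)
      + (iteratedDeriv (r + 2) (y i) t - iteratedDeriv (r + 2) (x i) t)|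
      ≤ κ * (((r + 1).factorial : ℝ) *
        ∑ k ∈ Finset.range (r + 1 + 1),
          kuD m κ a (p * (1 + t / m)) (Real.exp (-t / m)) (Real.exp (2 * κ * t)) k *
          kuH (Real.exp (-t / m)) (p * (1 + t / m)) a (r + 1 - k))
      + m * (κ * (((r + 2).factorial : ℝ) * (if r = 0 then 3 / 4 else 1) * a ^ (r + 2))) := by
  have hm := h.hm
  have hκ := h.hκ
  have hW := h.dW0
  have hV := h.dV0
  have ha0 : 0 < a := by rw [ha]; linarith
  have hp0 : 0 < p := by linarith
  have hau : a ≤ p * (1 + t / m) := by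
    have : 0 ≤ p * (t / m) := by positivity
    linarith
  have he0 := Real.exp_pos (-t / m)
  have he1 := ku_exp_le_one hm ht
  have hE := ku_one_le_exp hκ ht
  obtain ⟨P0, P1, Pm, Pu, Pa⟩ := kuH_props he0.le he1 ha0.le hau
  have D := abs_le.1 (ku_S_diff h.hN h.hκ h.ysm h.xsm t _ _
    (fun k => kuD_nonneg hm hκ ha0.le hau he0.le he1 hE k) P0 P1 Pm (r + 1)
    (fun k _ i j => h.yD ha hap hpm k t ht i j)
    (fun k _ i j => (h.xD ha t ht k i j).trans
      (mul_le_mul_of_nonneg_left (Pa (k + 1)) (by positivity))) hd i)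
  have b1 := h.oy i (r + 1) t ht
  have c1 := h.ox i (r + 1) t ht
  simp only [Nat.succ_ne_zero, if_false, zero_add] at b1 c1
  have X1 := mul_le_mul_of_nonneg_left (h.xthree ha t ht r i) hm.le
  rw [← abs_of_pos hm, ← abs_mul, abs_of_pos hm] at X1
  have X1' := abs_le.1 X1
  rw [abs_le]
  constructor <;> linarith [D.1, D.2, X1'.1, X1'.2]

lemma xinit (h : KuSys N m κ ν ω0 y x dW dV oW oV) {a p : ℝ} (ha : a = 2 * κ + dW + dV)
    (hap : a ≤ p) (hpm : 1 ≤ p * m) (r : ℕ) (i : Fin N) :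
    |iteratedDeriv (r + 2) (x i) 0| ≤ 1 / 2 * m * κ * ((r + 2).factorial : ℝ) * p ^ (r + 2) := by
  have hm := h.hm
  have hκ := h.hκ
  have hW := h.dW0
  have hV := h.dV0
  have ha0 : 0 < a := by rw [ha]; linarith
  have hp0 : 0 < p := by linarith
  refine (h.xsup ha 0 le_rfl r i).trans ?_
  have f2 : ((r + 2).factorial : ℝ) = ((r : ℝ) + 2) * ((r + 1).factorial : ℝ) := by
    rw [Nat.factorial_succ (r + 1)]; push_cast; ring
  rw [f2]
  have hr : (0 : ℝ) ≤ r := by positivity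
  calc κ * (((r + 1).factorial : ℝ) * a ^ (r + 1))
      ≤ κ * (((r + 1).factorial : ℝ) * p ^ (r + 1)) * 1 := by rw [mul_one]; gcongr
    _ ≤ κ * (((r + 1).factorial : ℝ) * p ^ (r + 1)) * (1 / 2 * ((r : ℝ) + 2) * (p * m)) := by
        gcongr
        nlinarith
    _ = _ := by ring

/-- pairwise differences -/
lemma dD (h : KuSys N m κ ν ω0 y x dW dV oW oV) {a p : ℝ} (ha : a = 2 * κ + dW + dV)
    (hap : a ≤ p) (hpm : 9 / 8 ≤ p * m) (k : ℕ) : ∀ t, 0 ≤ t → ∀ i j,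
    |(iteratedDeriv k (y j) t - iteratedDeriv k (x j) t)
      - (iteratedDeriv k (y i) t - iteratedDeriv k (x i) t)| ≤ (k.factorial : ℝ) *
        kuD m κ a (p * (1 + t / m)) (Real.exp (-t / m)) (Real.exp (2 * κ * t)) k := by
  have hm := h.hm
  have hκ := h.hκ
  have hW := h.dW0
  have hV := h.dV0
  have ha0 : 0 < a := by rw [ha]; linarith
  have hp0 : 0 < p := by linarith
  have hpm1 : 1 ≤ p * m := by linarith
  induction k using Nat.strong_induction_on with
  | _ k ih =>
    intro t ht i j
    rcases k with _ | _ | r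
    · simpa [kuD] using h.dD0 ha t ht i j
    · simpa [kuD] using h.dD1 ha t ht i j
    · have S := ku_step hm hκ (by linarith) hap hpm r 2 (((r + 1).factorial : ℝ) * p ^ (r + 2))
        (by norm_num)
        (fun t => (iteratedDeriv (r + 2) (y j) t - iteratedDeriv (r + 2) (x j) t)
          - (iteratedDeriv (r + 2) (y i) t - iteratedDeriv (r + 2) (x i) t))
        (fun t => (iteratedDeriv (r + 3) (y j) t - iteratedDeriv (r + 3) (x j) t)
          - (iteratedDeriv (r + 3) (y i) t - iteratedDeriv (r + 3) (x i) t))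
        (fun t => ((ku_hasDerivAt (h.ysm j) _ t).sub (ku_hasDerivAt (h.xsm j) _ t)).sub
          ((ku_hasDerivAt (h.ysm i) _ t).sub (ku_hasDerivAt (h.xsm i) _ t))) ?_ ?_ t ht
      · refine S.trans ?_
        have he0 := Real.exp_pos (-t / m)
        have hpu : p ≤ p * (1 + t / m) := by
          have : 0 ≤ p * (t / m) := by positivity
          linarith
        rw [kuD, if_neg (by omega), if_neg (by omega)]
        generalize p * (1 + t / m) = u at *
        have f3 : ((r + 3).factorial : ℝ) = ((r : ℝ) + 3) * ((r + 2).factorial : ℝ) := by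
          rw [Nat.factorial_succ (r + 2)]; push_cast; ring
        have q : ((r + 1).factorial : ℝ) * p ^ (r + 2) * Real.exp (-t / m)
            ≤ ((r + 2).factorial : ℝ) * u ^ (r + 2) * Real.exp (-t / m) := by
          gcongr
          omega
        rw [f3]
        push_cast
        simp only [show r + 1 + 1 = r + 2 from rfl]
        linarith
      · have a1 := abs_le.1 (h.yinit ha hap hpm1 (r + 1) i j)
        have a2 := abs_le.1 (h.xinit ha hap hpm1 r i)
        have a3 := abs_le.1 (h.xinit ha hap hpm1 r j)
        simp only [show r + 1 + 1 = r + 2 from rfl] at a1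
        have z : 0 ≤ m * κ * ((r + 2).factorial : ℝ) * p ^ (r + 2) := by positivity
        rw [abs_le]
        constructor <;> linarith [a1.1, a1.2, a2.1, a2.2, a3.1, a3.2]
      · intro t ht
        have Q := h.eqn ha hap hpm1 t ht r (fun k hk i j => ih k (by omega) t ht i j)
        have Q1 := abs_le.1 (Q i)
        have Q2 := abs_le.1 (Q j)
        rw [abs_le]
        constructor <;> linarith [Q1.1, Q1.2, Q2.1, Q2.2]

lemma ysup (h : KuSys N m κ ν ω0 y x dW dV oW oV) {a p P : ℝ} (ha : a = 2 * κ + dW + dV)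
    (hap : a ≤ p) (hpm : 1 ≤ p * m) (hP : 2 * κ + oW + oV ≤ P) (hPm : 1 ≤ P * m) (r : ℕ)
    (i : Fin N) :
    |iteratedDeriv (r + 2) (y i) 0| ≤ ((r + 1).factorial : ℝ) * P ^ (r + 2)
      + 1 / 2 * m * κ * ((r + 2).factorial : ℝ) * p ^ (r + 2) := by
  have hm := h.hm
  have hκ := h.hκ
  have hW := h.dW0
  have hV := h.dV0
  have hW' := h.oW0
  have hV' := h.oV0
  have ha0 : 0 < a := by rw [ha]; linarith
  have hp0 : 0 < p := by linarith
  have hP0 : 0 < P := by linarith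
  rw [← mul_le_mul_iff_left₀ hm]
  induction r with
  | zero =>
    have b1 := h.oy i 0 0 le_rfl
    simp only [if_true, zero_add, iteratedDeriv_one, h.vel] at b1
    have a1 := abs_le.1 (ku_S_zero h.hN h.hκ y i 0)
    have a2 := abs_le.1 (h.hoV i)
    have a3 := abs_le.1 (h.hoW i)
    simp only [zero_add]
    have e : |iteratedDeriv 2 (y i) 0| * m ≤ P := by
      rw [← abs_of_pos hm, ← abs_mul, abs_le]
      constructor <;> linarith [a1.1, a1.2, a2.1, a2.2, a3.1, a3.2]
    refine e.trans ?_
    have q : P ≤ P ^ 2 * m := by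
      calc P = P * 1 := by ring
        _ ≤ P * (P * m) := by gcongr
        _ = _ := by ring
    have z : 0 ≤ 1 / 2 * m * κ * ((2 : ℕ).factorial : ℝ) * p ^ 2 * m := by positivity
    simp only [Nat.factorial_one, Nat.cast_one, one_mul]
    linarith
  | succ r ih =>
    have ih' := (mul_le_mul_iff_left₀ hm).1 ih
    have b1 := h.oy i (r + 1) 0 le_rfl
    simp only [Nat.succ_ne_zero, if_false, zero_add] at b1
    obtain ⟨p1, p2, p3⟩ := ku_pow_props hp0.le
    have a1 := abs_le.1 (ku_S_bound h.hN h.hκ h.ysm 0 _ p1 p2 p3 (r + 1)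
      (fun l hl i j => h.yinit ha hap hpm l i j) i)
    have a2 := abs_le.1 ih'
    have e : |iteratedDeriv (r + 1 + 2) (y i) 0| * m ≤ κ * (((r + 1).factorial : ℝ) * p ^ (r + 1))
        + (((r + 1).factorial : ℝ) * P ^ (r + 2)
          + 1 / 2 * m * κ * ((r + 2).factorial : ℝ) * p ^ (r + 2)) := by
      rw [← abs_of_pos hm, ← abs_mul, abs_of_pos hm, abs_le]
      constructor <;> linarith [a1.1, a1.2, a2.1, a2.2]
    refine e.trans ?_
    have f2 : ((r + 2).factorial : ℝ) = ((r : ℝ) + 2) * ((r + 1).factorial : ℝ) := by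
      rw [Nat.factorial_succ (r + 1)]; push_cast; ring
    have f3 : ((r + 3).factorial : ℝ) = ((r : ℝ) + 3) * (((r : ℝ) + 2) * ((r + 1).factorial : ℝ)) := by
      rw [Nat.factorial_succ (r + 2), Nat.factorial_succ (r + 1)]; push_cast; ring
    simp only [show r + 1 + 1 = r + 2 from rfl, show r + 1 + 2 = r + 3 from rfl]
    rw [f3, f2]
    have hF : 0 < ((r + 1).factorial : ℝ) := by positivity
    generalize ((r + 1).factorial : ℝ) = F at *
    have hr : (0 : ℝ) ≤ r := by positivity
    have q1 : F * P ^ (r + 2) ≤ ((r : ℝ) + 2) * F * P ^ (r + 3) * m := by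
      calc F * P ^ (r + 2) = F * P ^ (r + 2) * 1 := by ring
        _ ≤ F * P ^ (r + 2) * (((r : ℝ) + 2) * (P * m)) := by
          gcongr
          nlinarith
        _ = _ := by ring
    have q2 : κ * F * p ^ (r + 1) * (1 + 1 / 2 * ((r : ℝ) + 2) * (p * m))
        ≤ κ * F * p ^ (r + 1) * (1 / 2 * ((r : ℝ) + 3) * ((r : ℝ) + 2) * (p * m) ^ 2) := by
      have s1 : p * m ≤ (p * m) ^ 2 := by nlinarith
      have s2 : 1 + 1 / 2 * ((r : ℝ) + 2) * (p * m)
          ≤ 1 / 2 * ((r : ℝ) + 3) * ((r : ℝ) + 2) * (p * m) := by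
        have : 1 ≤ (1 / 2 * ((r : ℝ) + 2) ^ 2) * (p * m) := by
          have : 1 ≤ 1 / 2 * ((r : ℝ) + 2) ^ 2 := by nlinarith
          nlinarith
        linarith
      have s3 : 1 / 2 * ((r : ℝ) + 3) * ((r : ℝ) + 2) * (p * m)
        ≤ 1 / 2 * ((r : ℝ) + 3) * ((r : ℝ) + 2) * (p * m) ^ 2 := by gcongr
      have := s2.trans s3
      gcongr
    have q3 : κ * F * p ^ (r + 1) * (1 + 1 / 2 * ((r : ℝ) + 2) * (p * m))
      = κ * (F * p ^ (r + 1)) + 1 / 2 * m * κ * (((r : ℝ) + 2) * F) * p ^ (r + 2) := by ring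
    have q4 : κ * F * p ^ (r + 1) * (1 / 2 * ((r : ℝ) + 3) * ((r : ℝ) + 2) * (p * m) ^ 2)
      = 1 / 2 * m * κ * (((r : ℝ) + 3) * (((r : ℝ) + 2) * F)) * p ^ (r + 3) * m := by ring
    linarith

lemma final (h : KuSys N m κ ν ω0 y x dW dV oW oV) {a p P : ℝ} (ha : a = 2 * κ + dW + dV)
    (hp : p = a + 9 / (8 * m)) (hP : P = 2 * κ + oW + oV + 9 / (8 * m)) (r : ℕ)
    (i : Fin N) (t : ℝ) (ht : 0 ≤ t) :
    |iteratedDeriv (r + 2) (y i) t - iteratedDeriv (r + 2) (x i) t| ≤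
      ((r + 1).factorial : ℝ) * P ^ (r + 2) * Real.exp (-t / m)
      + (9 / 8 * m * κ * ((r + 2).factorial : ℝ) *
        (Real.exp (2 * κ * t) * (p * (1 + t / m)) ^ (r + 1 + 1) * Real.exp (-t / m))
      + 3 / 4 * m * κ * ((r + 3).factorial : ℝ) * a ^ (r + 2) *
        (Real.exp (2 * κ * t) * (1 - Real.exp (-t / m)))) := by
  have hm := h.hm
  have hκ := h.hκ
  have hW := h.dW0
  have hV := h.dV0
  have hW' := h.oW0
  have hV' := h.oV0
  have ha0 : 0 < a := by rw [ha]; linarith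
  have h9 : 0 < 9 / (8 * m) := by positivity
  have h9m : 9 / (8 * m) * m = 9 / 8 := by field_simp
  have hap : a ≤ p := by linarith
  have hpm : 9 / 8 ≤ p * m := by
    rw [hp, add_mul, h9m]
    have : 0 ≤ a * m := by positivity
    linarith
  have hPm : 1 ≤ P * m := by
    rw [hP, add_mul, h9m]
    have : 0 ≤ (2 * κ + oW + oV) * m := by positivity
    linarith
  have hpm1 : 1 ≤ p * m := by linarith
  have hp0 : 0 < p := by linarith
  have S := ku_step hm hκ (by linarith) hap hpm r 1 (((r + 1).factorial : ℝ) * P ^ (r + 2))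
    (by norm_num)
    (fun t => (iteratedDeriv (r + 2) (y i) t - iteratedDeriv (r + 2) (x i) t))
    (fun t => (iteratedDeriv (r + 3) (y i) t - iteratedDeriv (r + 3) (x i) t))
    (fun t => (ku_hasDerivAt (h.ysm i) _ t).sub (ku_hasDerivAt (h.xsm i) _ t)) ?_ ?_ t ht
  · simpa only [one_mul] using S
  · have a1 := abs_le.1 (h.ysup ha hap hpm1 (by linarith) hPm r i)
    have a2 := abs_le.1 (h.xinit ha hap hpm1 r i)
    have z : 0 ≤ m * κ * ((r + 2).factorial : ℝ) * p ^ (r + 2) := by positivity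
    rw [abs_le]
    constructor <;> linarith [a1.1, a1.2, a2.1, a2.2]
  · intro t ht
    rw [one_mul]
    exact h.eqn ha hap hpm1 t ht r (fun k hk i j => h.dD ha hap hpm k t ht i j) i

end KuSys


/-- Proposition 3.2 (3): higher-order (`n ≥ 2`) quantitative Tikhonov bound
in the sup norm. -/
theorem stmt8 (N : ℕ) (hN : 1 ≤ N) (θ0 ω0 ν : Fin N → ℝ) (κ m : ℝ)
    (hκ : 0 < κ) (hm : 0 < m)
    (θm θz : Fin N → ℝ → ℝ)
    (hθm : IsInertialSol N m κ ν θ0 ω0 θm)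
    (hθz : IsFirstOrderSol N κ ν θ0 θz) :
    ∀ n : ℕ, 2 ≤ n → ∀ i, ∀ t : ℝ, 0 ≤ t →
      |iteratedDeriv n (θm i) t - iteratedDeriv n (θz i) t| ≤
        (Nat.factorial (n - 1) : ℝ) *
            (2 * κ + (⨆ j, |ω0 j|) + (⨆ j, |ν j|) + 9 / (8 * m)) ^ n *
            (1 + t / m) ^ n * Real.exp (-t / m) +
        9 / 8 * m * κ * (Nat.factorial n : ℝ) * Real.exp (2 * κ * t) *
            (2 * κ + (⨆ i, ⨆ j, |ω0 i - ω0 j|) + (⨆ i, ⨆ j, |ν i - ν j|) + 9 / (8 * m)) ^ n *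
            (1 + t / m) ^ n * Real.exp (-t / m) +
        3 / 4 * m * κ * (Nat.factorial (n + 1) : ℝ) * Real.exp (2 * κ * t) *
            (2 * κ + (⨆ i, ⨆ j, |ω0 i - ω0 j|) + (⨆ i, ⨆ j, |ν i - ν j|)) ^ n *
            (1 - Real.exp (-t / m)) := by
  intro n hn i t ht
  obtain ⟨r, rfl⟩ : ∃ r, n = r + 2 := ⟨n - 2, by omega⟩
  have bd1 : ∀ f : Fin N → ℝ, ∀ i, f i ≤ ⨆ j, f j := fun f i =>
    le_ciSup (Set.finite_range f).bddAbove i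
  have bd2 : ∀ f : Fin N → Fin N → ℝ, ∀ i j, f i j ≤ ⨆ i, ⨆ j, f i j := fun f i j =>
    (bd1 (f i) j).trans (bd1 (fun i => ⨆ j, f i j) i)
  have sys : KuSys N m κ ν ω0 θm θz (⨆ i, ⨆ j, |ω0 i - ω0 j|) (⨆ i, ⨆ j, |ν i - ν j|)
      (⨆ j, |ω0 j|) (⨆ j, |ν j|) :=
    { hN := hN
      hm := hm
      hκ := hκ
      ysm := fun i => (hθm.1 i).of_le le_top
      xsm := hθz.1
      init := fun i => by rw [hθm.2.1, hθz.2.1]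
      vel := hθm.2.2.1
      yode := hθm.2.2.2
      xode := hθz.2.2
      hdW := fun i j => bd2 (fun i j => |ω0 i - ω0 j|) i j
      hdV := fun i j => bd2 (fun i j => |ν i - ν j|) i j
      hoW := fun i => bd1 (fun i => |ω0 i|) i
      hoV := fun i => bd1 (fun i => |ν i|) i
      dW0 := Real.iSup_nonneg fun i => Real.iSup_nonneg fun j => abs_nonneg _
      dV0 := Real.iSup_nonneg fun i => Real.iSup_nonneg fun j => abs_nonneg _
      oW0 := Real.iSup_nonneg fun i => abs_nonneg _
      oV0 := Real.iSup_nonneg fun i => abs_nonneg _ }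
  have F := sys.final rfl rfl rfl r i t ht
  refine F.trans ?_
  have hW' := sys.oW0
  have hV' := sys.oV0
  rw [show r + 2 - 1 = r + 1 from rfl, show r + 2 + 1 = r + 3 from rfl,
    show r + 1 + 1 = r + 2 from rfl, mul_pow]
  have hs : 1 ≤ (1 + t / m) ^ (r + 2) := one_le_pow₀ (by
    have : 0 ≤ t / m := by positivity
    linarith)
  have q : ((r + 1).factorial : ℝ) *
      (2 * κ + (⨆ j, |ω0 j|) + (⨆ j, |ν j|) + 9 / (8 * m)) ^ (r + 2) * 1 * Real.exp (-t / m)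
      ≤ ((r + 1).factorial : ℝ) *
      (2 * κ + (⨆ j, |ω0 j|) + (⨆ j, |ν j|) + 9 / (8 * m)) ^ (r + 2) *
        (1 + t / m) ^ (r + 2) * Real.exp (-t / m) := by
    gcongr
  rw [mul_one] at q
  linarith
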